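/- Definability Lemma: for every type σ and every finite element d of the domain D_σ (i.e. every d that is the downward closure of a finite consistent set of primes of P(σ*)), there is a closed typed term M of type σ in the recursively typed λ-calculus with parallel case such that ⟦M⟧⊥ = d. -/

import Mathlib

set_option autoImplicit false

namespace RecLam

/-- Type expressions: type variables, separated sum, product, function space,
recursion `μt.τ`, and `void`. -/
inductive TyExpr : Type where
  | tvar : ℕ → TyExpr
  | sum : TyExpr → TyExpr → TyExpr
  | prod : TyExpr → TyExpr → TyExpr
  | arrow : TyExpr → TyExpr → TyExpr
  | mu : ℕ → TyExpr → TyExpr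
  | void : TyExpr
  deriving DecidableEq

namespace TyExpr

/-- Free type variables of a type expression. -/
def freeTV : TyExpr → Finset ℕ
  | .tvar t => {t}
  | .sum a b => freeTV a ∪ freeTV b
  | .prod a b => freeTV a ∪ freeTV b
  | .arrow a b => freeTV a ∪ freeTV b
  | .mu t a => (freeTV a).erase t
  | .void => ∅

/-- A type expression is closed (a *type*) iff it has no free type variables. -/
def Closed (τ : TyExpr) : Prop := freeTV τ = ∅

/-- `substTy σ t ρ` is `σ[ρ/t]`, substitution of `ρ` for the free occurrences of `t`. -/
def substTy : TyExpr → ℕ → TyExpr → TyExpr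
  | .tvar s, t, ρ => if s = t then ρ else .tvar s
  | .sum a b, t, ρ => .sum (substTy a t ρ) (substTy b t ρ)
  | .prod a b, t, ρ => .prod (substTy a t ρ) (substTy b t ρ)
  | .arrow a b, t, ρ => .arrow (substTy a t ρ) (substTy b t ρ)
  | .mu s a, t, ρ => if s = t then .mu s a else .mu s (substTy a t ρ)
  | .void, _, _ => .void

end TyExpr

/-- One-step unfolding `↝` of an outermost `μ`-redex. -/
inductive Unfold : TyExpr → TyExpr → Prop
  | mu (t : ℕ) (a : TyExpr) : Unfold (.mu t a) (TyExpr.substTy a t (.mu t a))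
  | sumL {a a' : TyExpr} (b : TyExpr) : Unfold a a' → Unfold (.sum a b) (.sum a' b)
  | sumR (a : TyExpr) {b b' : TyExpr} : Unfold b b' → Unfold (.sum a b) (.sum a b')
  | prodL {a a' : TyExpr} (b : TyExpr) : Unfold a a' → Unfold (.prod a b) (.prod a' b)
  | prodR (a : TyExpr) {b b' : TyExpr} : Unfold b b' → Unfold (.prod a b) (.prod a b')
  | arrowL {a a' : TyExpr} (b : TyExpr) : Unfold a a' → Unfold (.arrow a b) (.arrow a' b)
  | arrowR (a : TyExpr) {b b' : TyExpr} : Unfold b b' → Unfold (.arrow a b) (.arrow a b')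

/-- `↝*`, the reflexive transitive closure of one-step unfolding. -/
def Unfolds : TyExpr → TyExpr → Prop := Relation.ReflTransGen Unfold

/-- The `void`-prefix order `σ ≼ τ`: the least relation with `void ≼ τ` for all `τ`
and compatible with the constructors `+`, `×`, `→`.  Its left-hand sides are
exactly the simple types. -/
inductive Pre : TyExpr → TyExpr → Prop
  | void (τ : TyExpr) : Pre .void τ
  | sum {s s' t t' : TyExpr} : Pre s s' → Pre t t' → Pre (.sum s t) (.sum s' t')
  | prod {s s' t t' : TyExpr} : Pre s s' → Pre t t' → Pre (.prod s t) (.prod s' t')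
  | arrow {s s' t t' : TyExpr} : Pre s s' → Pre t t' → Pre (.arrow s t) (.arrow s' t')

/-- The unfolding `τ* = { σ ∈ T ∣ ∃ τ'. τ ↝* τ' ∧ σ ≼ τ' }` of a type `τ`. -/
def unfolding (τ : TyExpr) : Set TyExpr := {σ | ∃ τ', Unfolds τ τ' ∧ Pre σ τ'}

/-- Two types are equivalent iff they have the same unfolding as (regular) trees. -/
def TyEquiv (σ τ : TyExpr) : Prop := unfolding σ = unfolding τ

end RecLam

namespace RecLam

/-- The constants of the calculus, with their type subscripts. -/
inductive Const : Type where
  | czero : TyExpr → TyExpr → Const      -- 0_{σ,τ} : σ → (σ+τ)   ("inleft")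
  | cone : TyExpr → TyExpr → Const       -- 1_{σ,τ} : τ → (σ+τ)   ("inright")
  | ccase : TyExpr → TyExpr → TyExpr → Const   -- case_{σ,τ,ρ}
  | cpcase : TyExpr → TyExpr → TyExpr → Const  -- pcase_{σ,τ,ρ}
  | cpair : TyExpr → TyExpr → Const      -- pair_{σ,τ}
  | cfst : TyExpr → TyExpr → Const       -- fst_{σ,τ}
  | csnd : TyExpr → TyExpr → Const       -- snd_{σ,τ}
  | comega : TyExpr → Const              -- Ω_σ
  deriving DecidableEq

/-- The type of each constant. -/
def constType : Const → TyExpr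
  | .czero σ τ => .arrow σ (.sum σ τ)
  | .cone σ τ => .arrow τ (.sum σ τ)
  | .ccase σ τ ρ => .arrow (.sum σ τ) (.arrow (.arrow σ ρ) (.arrow (.arrow τ ρ) ρ))
  | .cpcase σ τ ρ => .arrow (.sum σ τ) (.arrow ρ (.arrow ρ ρ))
  | .cpair σ τ => .arrow σ (.arrow τ (.prod σ τ))
  | .cfst σ τ => .arrow (.prod σ τ) σ
  | .csnd σ τ => .arrow (.prod σ τ) τ
  | .comega σ => σ

/-- Terms, in de Bruijn representation (so terms are identified up to α-conversion):
variables, constants, application and λ-abstraction (the binder carries the type of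
the abstracted variable). -/
inductive Tm : Type where
  | var : ℕ → Tm
  | const : Const → Tm
  | app : Tm → Tm → Tm
  | lam : TyExpr → Tm → Tm
  deriving DecidableEq

/-- Lift (shift) the de Bruijn variables `≥ d` by one. -/
def liftTm (d : ℕ) : Tm → Tm
  | .var n => if n < d then .var n else .var (n + 1)
  | .const c => .const c
  | .app M N => .app (liftTm d M) (liftTm d N)
  | .lam σ M => .lam σ (liftTm (d + 1) M)

/-- Capture-avoiding substitution `M[k := N]` (de Bruijn). -/
def substTm : Tm → ℕ → Tm → Tm
  | .var n, k, N => if n = k then N else if k < n then .var (n - 1) else .var n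
  | .const c, _, _ => .const c
  | .app M P, k, N => .app (substTm M k N) (substTm P k N)
  | .lam σ M, k, N => .lam σ (substTm M (k + 1) (liftTm 0 N))

/-- The typing relation.  A context is a list of types of the free de Bruijn
variables.  It includes the rule (≈): a term of a type `σ` also has every type
equivalent to `σ`. -/
inductive HasType : List TyExpr → Tm → TyExpr → Prop
  | var {Γ : List TyExpr} {n : ℕ} {σ : TyExpr} :
      Γ[n]? = some σ → HasType Γ (.var n) σ
  | const {Γ : List TyExpr} (c : Const) : HasType Γ (.const c) (constType c)
  | app {Γ : List TyExpr} {M N : Tm} {σ τ : TyExpr} :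
      HasType Γ M (.arrow σ τ) → HasType Γ N σ → HasType Γ (.app M N) τ
  | lam {Γ : List TyExpr} {M : Tm} {σ τ : TyExpr} :
      HasType (σ :: Γ) M τ → HasType Γ (.lam σ M) (.arrow σ τ)
  | equiv {Γ : List TyExpr} {M : Tm} {σ τ : TyExpr} :
      HasType Γ M σ → TyEquiv σ τ → HasType Γ M τ

/-- One-step reduction: β-reduction, the ten rewrite rules for the constants,
closed under arbitrary contexts. -/
inductive Step : Tm → Tm → Prop
  | beta (σ : TyExpr) (M N : Tm) :
      Step (.app (.lam σ M) N) (substTm M 0 N)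
  | caseZero (σ τ ρ σ' τ' : TyExpr) (x y z : Tm) :
      Step (.app (.app (.app (.const (.ccase σ τ ρ)) (.app (.const (.czero σ' τ')) x)) y) z)
        (.app y x)
  | caseOne (σ τ ρ σ' τ' : TyExpr) (x y z : Tm) :
      Step (.app (.app (.app (.const (.ccase σ τ ρ)) (.app (.const (.cone σ' τ')) x)) y) z)
        (.app z x)
  | fstPair (σ τ σ' τ' : TyExpr) (x y : Tm) :
      Step (.app (.const (.cfst σ τ)) (.app (.app (.const (.cpair σ' τ')) x) y)) x
  | sndPair (σ τ σ' τ' : TyExpr) (x y : Tm) :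
      Step (.app (.const (.csnd σ τ)) (.app (.app (.const (.cpair σ' τ')) x) y)) y
  | pcaseZero (σ τ ρ σ' τ' : TyExpr) (x y z : Tm) :
      Step (.app (.app (.app (.const (.cpcase σ τ ρ)) (.app (.const (.czero σ' τ')) x)) y) z) y
  | pcaseOne (σ τ ρ σ' τ' : TyExpr) (x y z : Tm) :
      Step (.app (.app (.app (.const (.cpcase σ τ ρ)) (.app (.const (.cone σ' τ')) x)) y) z) z
  | pcaseZZ (σ τ ρ₀ ρ₁ σ₁ τ₁ σ₂ τ₂ : TyExpr) (x y z : Tm) :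
      Step (.app (.app (.app (.const (.cpcase σ τ (.sum ρ₀ ρ₁))) x)
              (.app (.const (.czero σ₁ τ₁)) y)) (.app (.const (.czero σ₂ τ₂)) z))
        (.app (.const (.czero ρ₀ ρ₁)) (.app (.app (.app (.const (.cpcase σ τ ρ₀)) x) y) z))
  | pcaseOO (σ τ ρ₀ ρ₁ σ₁ τ₁ σ₂ τ₂ : TyExpr) (x y z : Tm) :
      Step (.app (.app (.app (.const (.cpcase σ τ (.sum ρ₀ ρ₁))) x)
              (.app (.const (.cone σ₁ τ₁)) y)) (.app (.const (.cone σ₂ τ₂)) z))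
        (.app (.const (.cone ρ₀ ρ₁)) (.app (.app (.app (.const (.cpcase σ τ ρ₁)) x) y) z))
  | pcasePair (σ τ ρ₁ ρ₂ σ₁ τ₁ σ₂ τ₂ : TyExpr) (x y₁ y₂ z₁ z₂ : Tm) :
      Step (.app (.app (.app (.const (.cpcase σ τ (.prod ρ₁ ρ₂))) x)
              (.app (.app (.const (.cpair σ₁ τ₁)) y₁) y₂))
              (.app (.app (.const (.cpair σ₂ τ₂)) z₁) z₂))
        (.app (.app (.const (.cpair ρ₁ ρ₂))
            (.app (.app (.app (.const (.cpcase σ τ ρ₁)) x) y₁) z₁))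
          (.app (.app (.app (.const (.cpcase σ τ ρ₂)) x) y₂) z₂))
  | pcaseArrow (σ τ ρ₁ ρ₂ : TyExpr) (x y z w : Tm) :
      Step (.app (.app (.app (.app (.const (.cpcase σ τ (.arrow ρ₁ ρ₂))) x) y) z) w)
        (.app (.app (.app (.const (.cpcase σ τ ρ₂)) x) (.app y w)) (.app z w))
  | appL {M M' : Tm} (N : Tm) : Step M M' → Step (.app M N) (.app M' N)
  | appR (M : Tm) {N N' : Tm} : Step N N' → Step (.app M N) (.app M N')
  | lamC (σ : TyExpr) {M M' : Tm} : Step M M' → Step (.lam σ M) (.lam σ M')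

/-- `→*`, the reflexive transitive closure of one-step reduction. -/
def Steps : Tm → Tm → Prop := Relation.ReflTransGen Step

end RecLam

namespace RecLam

/-- The universe of primes for the prime-system interpretation of types:
`stag b` is the atom `b ∈ {0,1}` of a separated sum, `spr b a` is the pair `(b,a)`
of a separated sum, `ppr b a` is the pair `(b,a)` of a product, and `fn X a`
is the prime `(X, a)` of a function space (the finite set `X` is represented
as a list). -/
inductive Pm : Type where
  | stag : Bool → Pm
  | spr : Bool → Pm → Pm
  | ppr : Bool → Pm → Pm
  | fn : List Pm → Pm → Pm

/-- The data of a prime system on the universe `Pm`. -/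
structure PData where
  carrier : Set Pm
  con : Pm → Pm → Prop
  le : Pm → Pm → Prop

/-- The elements of a prime system: downward closed, pairwise consistent subsets
of the prime set. -/
def PData.IsElem (A : PData) (d : Set Pm) : Prop :=
  d ⊆ A.carrier ∧ (∀ a b : Pm, A.le a b → b ∈ d → a ∈ d) ∧ ∀ a ∈ d, ∀ b ∈ d, A.con a b

/-- The prime system of the type `void`: no primes. -/
def voidP : PData := ⟨∅, fun _ _ => False, fun _ _ => False⟩

/-- One side `{b} ∪ ({b} × A)` of a separated sum. -/
def sumSideP (A : PData) (b : Bool) : Set Pm :=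
  {p | p = .stag b ∨ ∃ a ∈ A.carrier, p = .spr b a}

/-- The separated sum of prime systems. -/
def sumP (A B : PData) : PData where
  carrier := sumSideP A false ∪ sumSideP B true
  con x y :=
    (x ∈ sumSideP A false ∧ y ∈ sumSideP A false ∧
      ∀ a b, x = .spr false a → y = .spr false b → A.con a b) ∨
    (x ∈ sumSideP B true ∧ y ∈ sumSideP B true ∧
      ∀ a b, x = .spr true a → y = .spr true b → B.con a b)
  le x y :=
    (x = .stag false ∧ y ∈ sumSideP A false) ∨
    (x = .stag true ∧ y ∈ sumSideP B true) ∨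
    (∃ a b, x = .spr false a ∧ y = .spr false b ∧ A.le a b) ∨
    (∃ a b, x = .spr true a ∧ y = .spr true b ∧ B.le a b)

/-- The cartesian product of prime systems. -/
def prodP (A B : PData) : PData where
  carrier := {p | (∃ a ∈ A.carrier, p = .ppr false a) ∨ ∃ b ∈ B.carrier, p = .ppr true b}
  con x y :=
    (∃ a b, x = .ppr false a ∧ y = .ppr false b ∧ A.con a b) ∨
    (∃ a b, x = .ppr true a ∧ y = .ppr true b ∧ B.con a b) ∨
    (∃ a b, x = .ppr false a ∧ y = .ppr true b ∧ a ∈ A.carrier ∧ b ∈ B.carrier) ∨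
    (∃ a b, x = .ppr true a ∧ y = .ppr false b ∧ a ∈ B.carrier ∧ b ∈ A.carrier)
  le x y :=
    (∃ a b, x = .ppr false a ∧ y = .ppr false b ∧ A.le a b) ∨
    (∃ a b, x = .ppr true a ∧ y = .ppr true b ∧ B.le a b)

/-- `X ∈ Ā`: the (finite) list `X` consists of primes of `A` that are pairwise
consistent and pairwise incomparable. -/
def goodList (A : PData) (X : List Pm) : Prop :=
  (∀ x ∈ X, x ∈ A.carrier) ∧ ∀ x ∈ X, ∀ y ∈ X, A.con x y ∧ (A.le x y → x = y)

/-- The function-space prime system `A → B`. -/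
def funcP (A B : PData) : PData where
  carrier := {p | ∃ X a, p = .fn X a ∧ goodList A X ∧ a ∈ B.carrier}
  con x y := ∃ X a Y b, x = .fn X a ∧ y = .fn Y b ∧
    goodList A X ∧ a ∈ B.carrier ∧ goodList A Y ∧ b ∈ B.carrier ∧
    ((∀ u ∈ X, ∀ v ∈ Y, A.con u v) → B.con a b)
  le x y := ∃ X a Y b, x = .fn X a ∧ y = .fn Y b ∧
    goodList A X ∧ a ∈ B.carrier ∧ goodList A Y ∧ b ∈ B.carrier ∧
    (∀ v ∈ Y, ∃ u ∈ X, A.le v u) ∧ B.le a b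

/-- Interpretation of simple types as prime systems. -/
def interpSimple : TyExpr → PData
  | .void => voidP
  | .tvar _ => voidP
  | .mu _ _ => voidP
  | .sum a b => sumP (interpSimple a) (interpSimple b)
  | .prod a b => prodP (interpSimple a) (interpSimple b)
  | .arrow a b => funcP (interpSimple a) (interpSimple b)

/-- The prime-system interpretation `P(τ*)` of a type `τ`: the lub (union) of the
interpretations of the simple prefixes of the unfoldings of `τ` (this directed
union equals the lub of the chain of finite approximations of the type tree
`τ*`). -/
def tyInterp (τ : TyExpr) : PData where
  carrier := {p | ∃ σ ∈ unfolding τ, p ∈ (interpSimple σ).carrier}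
  con x y := ∃ σ ∈ unfolding τ, (interpSimple σ).con x y
  le x y := ∃ σ ∈ unfolding τ, (interpSimple σ).le x y

/-- Application `|r|(d)` of (the function associated with) a set `r` of
function-space primes to a set `d` of primes. -/
def aps (r d : Set Pm) : Set Pm :=
  {b | ∃ X : List Pm, (∀ x ∈ X, x ∈ d) ∧ Pm.fn X b ∈ r}

/-- The downward closure `↓X` of a finite set (list) of primes in `A`. -/
def downListP (A : PData) (X : List Pm) : Set Pm := {a | ∃ x ∈ X, A.le a x}

/-- `Pr(f) = {(X, a) ∣ X ∈ Ā ∧ a ∈ f(↓X)}`, the element of a function-space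
prime system associated with a function `f` (on sets of primes of `A`). -/
def PrOf (A : PData) (f : Set Pm → Set Pm) : Set Pm :=
  {p | ∃ X a, p = Pm.fn X a ∧ goodList A X ∧ a ∈ f (downListP A X)}

/-- Semantic injection `0`: `d ↦ {0} ∪ ({0} × d)`. -/
def inj0 (d : Set Pm) : Set Pm := {p | p = .stag false ∨ ∃ a ∈ d, p = .spr false a}

/-- Semantic injection `1`: `d ↦ {1} ∪ ({1} × d)`. -/
def inj1 (d : Set Pm) : Set Pm := {p | p = .stag true ∨ ∃ a ∈ d, p = .spr true a}

/-- Semantic pairing: `(d, e) ↦ ({0} × d) ∪ ({1} × e)`. -/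
def pairS (d e : Set Pm) : Set Pm :=
  {p | (∃ a ∈ d, p = .ppr false a) ∨ ∃ b ∈ e, p = .ppr true b}

/-- First projection. -/
def fstS (d : Set Pm) : Set Pm := {a | Pm.ppr false a ∈ d}

/-- Second projection. -/
def sndS (d : Set Pm) : Set Pm := {a | Pm.ppr true a ∈ d}

/-- The component `e` of a sum element `0e` (resp. `1e`). -/
def prj0 (d : Set Pm) : Set Pm := {a | Pm.spr false a ∈ d}
def prj1 (d : Set Pm) : Set Pm := {a | Pm.spr true a ∈ d}

/-- The (strict) `case` function: `⊥` if `d = ⊥`, `|f|e` if `d = 0e`,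
`|g|e` if `d = 1e`. -/
def caseS (d f g : Set Pm) : Set Pm :=
  {b | (Pm.stag false ∈ d ∧ b ∈ aps f (prj0 d)) ∨ (Pm.stag true ∈ d ∧ b ∈ aps g (prj1 d))}

/-- The parallel `pcase` function: `b ∩ c` if `a = ⊥`, `b` if `a = 0a'`,
`c` if `a = 1a'`. -/
def pcaseS (a b c : Set Pm) : Set Pm :=
  {p | (Pm.stag false ∉ a ∧ Pm.stag true ∉ a ∧ p ∈ b ∩ c) ∨
       (Pm.stag false ∈ a ∧ p ∈ b) ∨ (Pm.stag true ∈ a ∧ p ∈ c)}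

/-- The semantics of the constants (the semantic functions are transported into
the domains by `Pr` and its curried variants). -/
def constSem : Const → Set Pm
  | .czero σ _ => PrOf (tyInterp σ) inj0
  | .cone _ τ => PrOf (tyInterp τ) inj1
  | .ccase σ τ ρ =>
      PrOf (tyInterp (.sum σ τ)) fun d =>
        PrOf (tyInterp (.arrow σ ρ)) fun f =>
          PrOf (tyInterp (.arrow τ ρ)) fun g => caseS d f g
  | .cpcase σ τ ρ =>
      PrOf (tyInterp (.sum σ τ)) fun a =>
        PrOf (tyInterp ρ) fun b =>
          PrOf (tyInterp ρ) fun c => pcaseS a b c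
  | .cpair σ τ =>
      PrOf (tyInterp σ) fun d => PrOf (tyInterp τ) fun e => pairS d e
  | .cfst σ τ => PrOf (tyInterp (.prod σ τ)) fstS
  | .csnd σ τ => PrOf (tyInterp (.prod σ τ)) sndS
  | .comega _ => ∅

/-- Environments assign a domain element (a set of primes) to every de Bruijn
variable. -/
def Env : Type := ℕ → Set Pm

/-- Extend an environment by a value for the variable `0` (de Bruijn cons). -/
def envCons (d : Set Pm) (ε : Env) : Env :=
  fun n => match n with
  | 0 => d
  | n + 1 => ε n

/-- The denotational semantics `⟦M⟧ε` of a term. -/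
def sem : Tm → Env → Set Pm
  | .var n, ε => ε n
  | .const c, _ => constSem c
  | .app M N, ε => aps (sem M ε) (sem N ε)
  | .lam σ M, ε => PrOf (tyInterp σ) fun d => sem M (envCons d ε)

/-- An environment is typed by a context `Γ` iff it maps each variable to an
element of the domain of its type. -/
def GoodEnv (Γ : List TyExpr) (ε : Env) : Prop :=
  ∀ (n : ℕ) (σ : TyExpr), Γ[n]? = some σ → (tyInterp σ).IsElem (ε n)

/-- The environment assigning `⊥ = ∅` to every variable. -/
def botEnv : Env := fun _ => ∅

end RecLam

namespace RecLam

/-! ### Unfoldings of types -/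

theorem Unfold.diamond {a b : TyExpr} (h : Unfold a b) :
    ∀ c, Unfold a c → b = c ∨ ∃ d, Unfold b d ∧ Unfold c d := by
  induction h with
  | mu t a => intro c hc; cases hc; exact Or.inl rfl
  | sumL b h ih =>
    intro c hc
    cases hc with
    | sumL _ h' =>
      rcases ih _ h' with rfl | ⟨d, h1, h2⟩
      · exact Or.inl rfl
      · exact Or.inr ⟨_, .sumL _ h1, .sumL _ h2⟩
    | sumR _ h' => exact Or.inr ⟨_, .sumR _ h', .sumL _ h⟩
  | sumR b h ih =>
    intro c hc
    cases hc with
    | sumR _ h' =>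
      rcases ih _ h' with rfl | ⟨d, h1, h2⟩
      · exact Or.inl rfl
      · exact Or.inr ⟨_, .sumR _ h1, .sumR _ h2⟩
    | sumL _ h' => exact Or.inr ⟨_, .sumL _ h', .sumR _ h⟩
  | prodL b h ih =>
    intro c hc
    cases hc with
    | prodL _ h' =>
      rcases ih _ h' with rfl | ⟨d, h1, h2⟩
      · exact Or.inl rfl
      · exact Or.inr ⟨_, .prodL _ h1, .prodL _ h2⟩
    | prodR _ h' => exact Or.inr ⟨_, .prodR _ h', .prodL _ h⟩
  | prodR b h ih =>
    intro c hc
    cases hc with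
    | prodR _ h' =>
      rcases ih _ h' with rfl | ⟨d, h1, h2⟩
      · exact Or.inl rfl
      · exact Or.inr ⟨_, .prodR _ h1, .prodR _ h2⟩
    | prodL _ h' => exact Or.inr ⟨_, .prodL _ h', .prodR _ h⟩
  | arrowL b h ih =>
    intro c hc
    cases hc with
    | arrowL _ h' =>
      rcases ih _ h' with rfl | ⟨d, h1, h2⟩
      · exact Or.inl rfl
      · exact Or.inr ⟨_, .arrowL _ h1, .arrowL _ h2⟩
    | arrowR _ h' => exact Or.inr ⟨_, .arrowR _ h', .arrowL _ h⟩
  | arrowR b h ih =>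
    intro c hc
    cases hc with
    | arrowR _ h' =>
      rcases ih _ h' with rfl | ⟨d, h1, h2⟩
      · exact Or.inl rfl
      · exact Or.inr ⟨_, .arrowR _ h1, .arrowR _ h2⟩
    | arrowL _ h' => exact Or.inr ⟨_, .arrowL _ h', .arrowR _ h⟩

theorem Unfolds.confl {a b c : TyExpr} (h : Unfolds a b) (h' : Unfolds a c) :
    ∃ d, Unfolds b d ∧ Unfolds c d := by
  refine Relation.church_rosser (r := Unfold) ?_ h h'
  intro a b c hb hc
  rcases hb.diamond c hc with rfl | ⟨d, h1, h2⟩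
  · exact ⟨b, .refl, .refl⟩
  · exact ⟨d, .single h1, .single h2⟩

theorem Pre.unfold {s t : TyExpr} (h : Pre s t) : ∀ t', Unfold t t' → Pre s t' := by
  induction h with
  | void => intro t' _; exact .void _
  | sum h1 h2 ih1 ih2 =>
    intro t' ht
    cases ht with
    | sumL _ h => exact .sum (ih1 _ h) h2
    | sumR _ h => exact .sum h1 (ih2 _ h)
  | prod h1 h2 ih1 ih2 =>
    intro t' ht
    cases ht with
    | prodL _ h => exact .prod (ih1 _ h) h2
    | prodR _ h => exact .prod h1 (ih2 _ h)
  | arrow h1 h2 ih1 ih2 =>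
    intro t' ht
    cases ht with
    | arrowL _ h => exact .arrow (ih1 _ h) h2
    | arrowR _ h => exact .arrow h1 (ih2 _ h)

theorem Pre.unfolds {s t t' : TyExpr} (h : Pre s t) (ht : Unfolds t t') : Pre s t' := by
  induction ht with
  | refl => exact h
  | tail _ h2 ih => exact ih.unfold _ h2

theorem Pre.lub {s t : TyExpr} (h : Pre s t) :
    ∀ s', Pre s' t → ∃ u, Pre s u ∧ Pre s' u ∧ Pre u t := by
  induction h with
  | void τ =>
    intro s' h'
    refine ⟨s', .void _, ?_, h'⟩
    induction h' with
    | void => exact .void _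
    | sum _ _ i j => exact .sum i j
    | prod _ _ i j => exact .prod i j
    | arrow _ _ i j => exact .arrow i j
  | sum h1 h2 ih1 ih2 =>
    intro s' h'
    cases h' with
    | void =>
      obtain ⟨u, a, b, c⟩ := ih1 _ (.void _)
      obtain ⟨u', a', b', c'⟩ := ih2 _ (.void _)
      exact ⟨_, .sum a a', .void _, .sum c c'⟩
    | sum k1 k2 =>
      obtain ⟨u, a, b, c⟩ := ih1 _ k1
      obtain ⟨u', a', b', c'⟩ := ih2 _ k2
      exact ⟨_, .sum a a', .sum b b', .sum c c'⟩
  | prod h1 h2 ih1 ih2 =>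
    intro s' h'
    cases h' with
    | void =>
      obtain ⟨u, a, b, c⟩ := ih1 _ (.void _)
      obtain ⟨u', a', b', c'⟩ := ih2 _ (.void _)
      exact ⟨_, .prod a a', .void _, .prod c c'⟩
    | prod k1 k2 =>
      obtain ⟨u, a, b, c⟩ := ih1 _ k1
      obtain ⟨u', a', b', c'⟩ := ih2 _ k2
      exact ⟨_, .prod a a', .prod b b', .prod c c'⟩
  | arrow h1 h2 ih1 ih2 =>
    intro s' h'
    cases h' with
    | void =>
      obtain ⟨u, a, b, c⟩ := ih1 _ (.void _)
      obtain ⟨u', a', b', c'⟩ := ih2 _ (.void _)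
      exact ⟨_, .arrow a a', .void _, .arrow c c'⟩
    | arrow k1 k2 =>
      obtain ⟨u, a, b, c⟩ := ih1 _ k1
      obtain ⟨u', a', b', c'⟩ := ih2 _ k2
      exact ⟨_, .arrow a a', .arrow b b', .arrow c c'⟩

theorem unfolding_directed {τ s t : TyExpr} (hs : s ∈ unfolding τ) (ht : t ∈ unfolding τ) :
    ∃ u ∈ unfolding τ, Pre s u ∧ Pre t u := by
  obtain ⟨a, ha, hs⟩ := hs
  obtain ⟨b, hb, ht⟩ := ht
  obtain ⟨c, h1, h2⟩ := ha.confl hb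
  obtain ⟨u, x, y, z⟩ := (hs.unfolds h1).lub _ (ht.unfolds h2)
  exact ⟨u, ⟨c, ha.trans h1, z⟩, x, y⟩

theorem unfolding_eq {τ τ' : TyExpr} (h : Unfolds τ τ') : unfolding τ = unfolding τ' := by
  ext s
  constructor
  · rintro ⟨a, ha, hs⟩
    obtain ⟨c, h1, h2⟩ := ha.confl h
    exact ⟨c, h2, hs.unfolds h1⟩
  · rintro ⟨a, ha, hs⟩
    exact ⟨a, h.trans ha, hs⟩

theorem void_mem_unfolding (τ : TyExpr) : TyExpr.void ∈ unfolding τ :=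
  ⟨τ, .refl, .void _⟩

theorem Unfolds.sum {a a' b b' : TyExpr} (h : Unfolds a a') (h' : Unfolds b b') :
    Unfolds (.sum a b) (.sum a' b') :=
  (Relation.ReflTransGen.lift (fun x => TyExpr.sum x b) (fun _ _ h => Unfold.sumL b h) _ _ h).trans
    (Relation.ReflTransGen.lift (fun x => TyExpr.sum a' x) (fun _ _ h => Unfold.sumR a' h) _ _ h')

theorem Unfolds.prod {a a' b b' : TyExpr} (h : Unfolds a a') (h' : Unfolds b b') :
    Unfolds (.prod a b) (.prod a' b') :=
  (Relation.ReflTransGen.lift (fun x => TyExpr.prod x b) (fun _ _ h => Unfold.prodL b h) _ _ h).trans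
    (Relation.ReflTransGen.lift (fun x => TyExpr.prod a' x) (fun _ _ h => Unfold.prodR a' h) _ _ h')

theorem Unfolds.arrow {a a' b b' : TyExpr} (h : Unfolds a a') (h' : Unfolds b b') :
    Unfolds (.arrow a b) (.arrow a' b') :=
  (Relation.ReflTransGen.lift (fun x => TyExpr.arrow x b) (fun _ _ h => Unfold.arrowL b h) _ _ h).trans
    (Relation.ReflTransGen.lift (fun x => TyExpr.arrow a' x) (fun _ _ h => Unfold.arrowR a' h) _ _ h')

theorem Unfolds.sum_inv {a b t : TyExpr} (h : Unfolds (.sum a b) t) :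
    ∃ a' b', t = .sum a' b' ∧ Unfolds a a' ∧ Unfolds b b' := by
  induction h with
  | refl => exact ⟨a, b, rfl, .refl, .refl⟩
  | tail _ h ih =>
    obtain ⟨a', b', rfl, h1, h2⟩ := ih
    cases h with
    | sumL _ h => exact ⟨_, _, rfl, h1.tail h, h2⟩
    | sumR _ h => exact ⟨_, _, rfl, h1, h2.tail h⟩

theorem Unfolds.prod_inv {a b t : TyExpr} (h : Unfolds (.prod a b) t) :
    ∃ a' b', t = .prod a' b' ∧ Unfolds a a' ∧ Unfolds b b' := by
  induction h with
  | refl => exact ⟨a, b, rfl, .refl, .refl⟩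
  | tail _ h ih =>
    obtain ⟨a', b', rfl, h1, h2⟩ := ih
    cases h with
    | prodL _ h => exact ⟨_, _, rfl, h1.tail h, h2⟩
    | prodR _ h => exact ⟨_, _, rfl, h1, h2.tail h⟩

theorem Unfolds.arrow_inv {a b t : TyExpr} (h : Unfolds (.arrow a b) t) :
    ∃ a' b', t = .arrow a' b' ∧ Unfolds a a' ∧ Unfolds b b' := by
  induction h with
  | refl => exact ⟨a, b, rfl, .refl, .refl⟩
  | tail _ h ih =>
    obtain ⟨a', b', rfl, h1, h2⟩ := ih
    cases h with
    | arrowL _ h => exact ⟨_, _, rfl, h1.tail h, h2⟩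
    | arrowR _ h => exact ⟨_, _, rfl, h1, h2.tail h⟩

theorem mem_unfolding_sum {a b s : TyExpr} : s ∈ unfolding (.sum a b) ↔
    s = .void ∨ ∃ x ∈ unfolding a, ∃ y ∈ unfolding b, s = .sum x y := by
  constructor
  · rintro ⟨t, ht, hs⟩
    obtain ⟨a', b', rfl, h1, h2⟩ := ht.sum_inv
    cases hs with
    | void => exact Or.inl rfl
    | sum k1 k2 => exact Or.inr ⟨_, ⟨_, h1, k1⟩, _, ⟨_, h2, k2⟩, rfl⟩
  · rintro (rfl | ⟨x, ⟨a', h1, k1⟩, y, ⟨b', h2, k2⟩, rfl⟩)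
    · exact void_mem_unfolding _
    · exact ⟨_, h1.sum h2, .sum k1 k2⟩

theorem mem_unfolding_prod {a b s : TyExpr} : s ∈ unfolding (.prod a b) ↔
    s = .void ∨ ∃ x ∈ unfolding a, ∃ y ∈ unfolding b, s = .prod x y := by
  constructor
  · rintro ⟨t, ht, hs⟩
    obtain ⟨a', b', rfl, h1, h2⟩ := ht.prod_inv
    cases hs with
    | void => exact Or.inl rfl
    | prod k1 k2 => exact Or.inr ⟨_, ⟨_, h1, k1⟩, _, ⟨_, h2, k2⟩, rfl⟩
  · rintro (rfl | ⟨x, ⟨a', h1, k1⟩, y, ⟨b', h2, k2⟩, rfl⟩)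
    · exact void_mem_unfolding _
    · exact ⟨_, h1.prod h2, .prod k1 k2⟩

theorem mem_unfolding_arrow {a b s : TyExpr} : s ∈ unfolding (.arrow a b) ↔
    s = .void ∨ ∃ x ∈ unfolding a, ∃ y ∈ unfolding b, s = .arrow x y := by
  constructor
  · rintro ⟨t, ht, hs⟩
    obtain ⟨a', b', rfl, h1, h2⟩ := ht.arrow_inv
    cases hs with
    | void => exact Or.inl rfl
    | arrow k1 k2 => exact Or.inr ⟨_, ⟨_, h1, k1⟩, _, ⟨_, h2, k2⟩, rfl⟩
  · rintro (rfl | ⟨x, ⟨a', h1, k1⟩, y, ⟨b', h2, k2⟩, rfl⟩)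
    · exact void_mem_unfolding _
    · exact ⟨_, h1.arrow h2, .arrow k1 k2⟩

/-! ### Laws of prime systems and substructures -/

/-- The laws of a prime system (as a preorder). -/
structure Laws (A : PData) : Prop where
  con_mem : ∀ x y, A.con x y → x ∈ A.carrier ∧ y ∈ A.carrier
  le_mem : ∀ x y, A.le x y → x ∈ A.carrier ∧ y ∈ A.carrier
  le_refl : ∀ x ∈ A.carrier, A.le x x
  le_trans : ∀ x y z, A.le x y → A.le y z → A.le x z
  con_refl : ∀ x ∈ A.carrier, A.con x x
  con_symm : ∀ x y, A.con x y → A.con y x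
  con_down : ∀ x y z, A.le x y → A.con y z → A.con x z

/-- `A` is an (induced) substructure of `B`. -/
structure Sub (A B : PData) : Prop where
  car : ∀ x ∈ A.carrier, x ∈ B.carrier
  con : ∀ x ∈ A.carrier, ∀ y ∈ A.carrier, (A.con x y ↔ B.con x y)
  le : ∀ x ∈ A.carrier, ∀ y ∈ A.carrier, (A.le x y ↔ B.le x y)

theorem laws_void : Laws voidP := by
  constructor <;> simp [voidP]

theorem laws_sum {A B : PData} (hA : Laws A) (hB : Laws B) : Laws (sumP A B) := by
  obtain ⟨a1, a2, a3, a4, a5, a6, a7⟩ := hA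
  obtain ⟨b1, b2, b3, b4, b5, b6, b7⟩ := hB
  constructor
  · simp only [sumP]; grind
  · simp only [sumP, sumSideP]; grind
  · simp only [sumP, sumSideP]; grind
  · simp only [sumP, sumSideP]; grind
  · simp only [sumP, sumSideP]; grind
  · simp only [sumP, sumSideP]; grind
  · simp only [sumP, sumSideP]; grind

theorem laws_prod {A B : PData} (hA : Laws A) (hB : Laws B) : Laws (prodP A B) := by
  obtain ⟨a1, a2, a3, a4, a5, a6, a7⟩ := hA
  obtain ⟨b1, b2, b3, b4, b5, b6, b7⟩ := hB
  constructor
  · simp only [prodP]; grind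
  · simp only [prodP]; grind
  · simp only [prodP]; grind
  · simp only [prodP]; grind
  · simp only [prodP]; grind
  · simp only [prodP]; grind
  · simp only [prodP]; grind

theorem laws_func {A B : PData} (hA : Laws A) (hB : Laws B) : Laws (funcP A B) := by
  constructor
  · rintro x y ⟨X, a, Y, b, rfl, rfl, h1, h2, h3, h4, -⟩
    exact ⟨⟨X, a, rfl, h1, h2⟩, ⟨Y, b, rfl, h3, h4⟩⟩
  · rintro x y ⟨X, a, Y, b, rfl, rfl, h1, h2, h3, h4, -⟩
    exact ⟨⟨X, a, rfl, h1, h2⟩, ⟨Y, b, rfl, h3, h4⟩⟩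
  · rintro x ⟨X, a, rfl, h1, h2⟩
    exact ⟨X, a, X, a, rfl, rfl, h1, h2, h1, h2, fun v hv => ⟨v, hv, hA.le_refl _ (h1.1 v hv)⟩,
      hB.le_refl _ h2⟩
  · rintro x y z ⟨X, a, Y, b, rfl, rfl, h1, h2, h3, h4, h5, h6⟩
      ⟨Y', b', Z, c, e, rfl, h1', h2', h3', h4', h5', h6'⟩
    cases e
    refine ⟨X, a, Z, c, rfl, rfl, h1, h2, h3', h4', fun v hv => ?_, hB.le_trans _ _ _ h6 h6'⟩
    obtain ⟨u, hu, k⟩ := h5' v hv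
    obtain ⟨w, hw, k'⟩ := h5 u hu
    exact ⟨w, hw, hA.le_trans _ _ _ k k'⟩
  · rintro x ⟨X, a, rfl, h1, h2⟩
    exact ⟨X, a, X, a, rfl, rfl, h1, h2, h1, h2, fun _ => hB.con_refl _ h2⟩
  · rintro x y ⟨X, a, Y, b, rfl, rfl, h1, h2, h3, h4, h5⟩
    exact ⟨Y, b, X, a, rfl, rfl, h3, h4, h1, h2, fun h => hB.con_symm _ _
      (h5 fun u hu v hv => hA.con_symm _ _ (h v hv u hu))⟩
  · rintro x y z ⟨X, a, Y, b, rfl, rfl, h1, h2, h3, h4, h5, h6⟩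
      ⟨Y', b', Z, c, e, rfl, h1', h2', h3', h4', h5'⟩
    cases e
    refine ⟨X, a, Z, c, rfl, rfl, h1, h2, h3', h4', fun h => hB.con_down _ _ _ h6 (h5' ?_)⟩
    intro v hv w hw
    obtain ⟨u, hu, k⟩ := h5 v hv
    exact hA.con_down _ _ _ k (h u hu w hw)

theorem laws_simple (s : TyExpr) : Laws (interpSimple s) := by
  induction s with
  | void => exact laws_void
  | tvar => exact laws_void
  | mu => exact laws_void
  | sum a b iha ihb => exact laws_sum iha ihb
  | prod a b iha ihb => exact laws_prod iha ihb
  | arrow a b iha ihb => exact laws_func iha ihb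

theorem sub_void (A : PData) : Sub voidP A := by
  constructor <;> simp [voidP]

theorem sub_sum {A B A' B' : PData} (hA : Sub A A') (hB : Sub B B') :
    Sub (sumP A B) (sumP A' B') := by
  obtain ⟨a1, a2, a3⟩ := hA
  obtain ⟨b1, b2, b3⟩ := hB
  constructor
  · rintro _ ((rfl | ⟨a, ha, rfl⟩) | (rfl | ⟨a, ha, rfl⟩))
    · exact .inl (.inl rfl)
    · exact .inl (.inr ⟨a, a1 a ha, rfl⟩)
    · exact .inr (.inl rfl)
    · exact .inr (.inr ⟨a, b1 a ha, rfl⟩)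
  · simp only [sumP, sumSideP]
    rintro _ ((rfl | ⟨a, ha, rfl⟩) | (rfl | ⟨a, ha, rfl⟩)) _
      ((rfl | ⟨b, hb, rfl⟩) | (rfl | ⟨b, hb, rfl⟩)) <;> simp [*]
  · simp only [sumP, sumSideP]
    rintro _ ((rfl | ⟨a, ha, rfl⟩) | (rfl | ⟨a, ha, rfl⟩)) _
      ((rfl | ⟨b, hb, rfl⟩) | (rfl | ⟨b, hb, rfl⟩)) <;> simp [*]

theorem sub_prod {A B A' B' : PData} (hA : Sub A A') (hB : Sub B B') :
    Sub (prodP A B) (prodP A' B') := by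
  obtain ⟨a1, a2, a3⟩ := hA
  obtain ⟨b1, b2, b3⟩ := hB
  constructor
  · simp only [prodP]; grind
  · simp only [prodP]
    rintro _ (⟨a, ha, rfl⟩ | ⟨a, ha, rfl⟩) _ (⟨b, hb, rfl⟩ | ⟨b, hb, rfl⟩) <;> simp [*]
  · simp only [prodP]
    rintro _ (⟨a, ha, rfl⟩ | ⟨a, ha, rfl⟩) _ (⟨b, hb, rfl⟩ | ⟨b, hb, rfl⟩) <;> simp [*]

theorem Sub.good {A A' : PData} (h : Sub A A') {X : List Pm} (hX : ∀ x ∈ X, x ∈ A.carrier) :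
    goodList A X ↔ goodList A' X := by
  constructor
  · rintro ⟨-, k⟩
    refine ⟨fun x hx => h.car x (hX x hx), fun x hx y hy => ?_⟩
    rw [← h.con _ (hX x hx) _ (hX y hy), ← h.le _ (hX x hx) _ (hX y hy)]
    exact k x hx y hy
  · rintro ⟨-, k⟩
    refine ⟨hX, fun x hx y hy => ?_⟩
    rw [h.con _ (hX x hx) _ (hX y hy), h.le _ (hX x hx) _ (hX y hy)]
    exact k x hx y hy

theorem sub_func {A B A' B' : PData} (hA : Sub A A') (hB : Sub B B') :
    Sub (funcP A B) (funcP A' B') := by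
  constructor
  · rintro _ ⟨X, a, rfl, h1, h2⟩
    exact ⟨X, a, rfl, (hA.good h1.1).1 h1, hB.car _ h2⟩
  · rintro _ ⟨X, a, rfl, h1, h2⟩ _ ⟨Y, b, rfl, h3, h4⟩
    have e : (∀ u ∈ X, ∀ v ∈ Y, A.con u v) ↔ (∀ u ∈ X, ∀ v ∈ Y, A'.con u v) := by
      refine forall₂_congr fun u hu => forall₂_congr fun v hv => ?_
      exact hA.con _ (h1.1 u hu) _ (h3.1 v hv)
    have e2 := hB.con _ h2 _ h4
    have g1 := (hA.good h1.1).1 h1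
    have g2 := (hA.good h3.1).1 h3
    have g3 := hB.car _ h2
    have g4 := hB.car _ h4
    constructor
    · rintro ⟨X', a', Y', b', r1, r2, -, -, -, -, k⟩
      cases r1; cases r2
      exact ⟨X, a, Y, b, rfl, rfl, g1, g3, g2, g4, by rwa [← e, ← e2]⟩
    · rintro ⟨X', a', Y', b', r1, r2, -, -, -, -, k⟩
      cases r1; cases r2
      exact ⟨X, a, Y, b, rfl, rfl, h1, h2, h3, h4, by rwa [e, e2]⟩
  · rintro _ ⟨X, a, rfl, h1, h2⟩ _ ⟨Y, b, rfl, h3, h4⟩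
    have e : (∀ v ∈ Y, ∃ u ∈ X, A.le v u) ↔ (∀ v ∈ Y, ∃ u ∈ X, A'.le v u) := by
      refine forall₂_congr fun v hv => exists_congr fun u => and_congr_right fun hu => ?_
      exact hA.le _ (h3.1 v hv) _ (h1.1 u hu)
    have e2 := hB.le _ h2 _ h4
    have g1 := (hA.good h1.1).1 h1
    have g2 := (hA.good h3.1).1 h3
    have g3 := hB.car _ h2
    have g4 := hB.car _ h4
    constructor
    · rintro ⟨X', a', Y', b', r1, r2, -, -, -, -, k⟩
      cases r1; cases r2
      exact ⟨X, a, Y, b, rfl, rfl, g1, g3, g2, g4, by rwa [← e, ← e2]⟩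
    · rintro ⟨X', a', Y', b', r1, r2, -, -, -, -, k⟩
      cases r1; cases r2
      exact ⟨X, a, Y, b, rfl, rfl, h1, h2, h3, h4, by rwa [e, e2]⟩

theorem sub_of_pre {s t : TyExpr} (h : Pre s t) : Sub (interpSimple s) (interpSimple t) := by
  induction h with
  | void => exact sub_void _
  | sum _ _ i j => exact sub_sum i j
  | prod _ _ i j => exact sub_prod i j
  | arrow _ _ i j => exact sub_func i j

/-! ### The interpretation of types -/

theorem sub_tyInterp {s τ : TyExpr} (h : s ∈ unfolding τ) :
    Sub (interpSimple s) (tyInterp τ) := by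
  constructor
  · intro x hx; exact ⟨s, h, hx⟩
  · intro x hx y hy
    constructor
    · intro k; exact ⟨s, h, k⟩
    · rintro ⟨t, ht, k⟩
      obtain ⟨u, hu, h1, h2⟩ := unfolding_directed h ht
      obtain ⟨m1, m2⟩ := (laws_simple t).con_mem _ _ k
      exact ((sub_of_pre h1).con _ hx _ hy).2 (((sub_of_pre h2).con _ m1 _ m2).1 k)
  · intro x hx y hy
    constructor
    · intro k; exact ⟨s, h, k⟩
    · rintro ⟨t, ht, k⟩
      obtain ⟨u, hu, h1, h2⟩ := unfolding_directed h ht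
      obtain ⟨m1, m2⟩ := (laws_simple t).le_mem _ _ k
      exact ((sub_of_pre h1).le _ hx _ hy).2 (((sub_of_pre h2).le _ m1 _ m2).1 k)

theorem common_simple {τ : TyExpr} (X : List Pm) (hX : ∀ x ∈ X, x ∈ (tyInterp τ).carrier) :
    ∃ s ∈ unfolding τ, ∀ x ∈ X, x ∈ (interpSimple s).carrier := by
  induction X with
  | nil => exact ⟨_, void_mem_unfolding _, by simp⟩
  | cons a X ih =>
    obtain ⟨s, hs, h1⟩ := ih fun x hx => hX x (List.mem_cons_of_mem _ hx)
    obtain ⟨t, ht, h2⟩ := hX a List.mem_cons_self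
    obtain ⟨u, hu, k1, k2⟩ := unfolding_directed hs ht
    refine ⟨u, hu, fun x hx => ?_⟩
    rcases List.mem_cons.1 hx with rfl | hx
    · exact (sub_of_pre k2).car _ h2
    · exact (sub_of_pre k1).car _ (h1 x hx)

theorem tyInterp_eq {τ : TyExpr} {P : PData} (hP : Laws P)
    (h1 : ∀ s ∈ unfolding τ, Sub (interpSimple s) P)
    (h2 : ∀ x ∈ P.carrier, ∀ y ∈ P.carrier, ∃ s ∈ unfolding τ,
      x ∈ (interpSimple s).carrier ∧ y ∈ (interpSimple s).carrier) : tyInterp τ = P := by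
  have e1 : (tyInterp τ).carrier = P.carrier := by
    ext x
    constructor
    · rintro ⟨s, hs, hx⟩; exact (h1 s hs).car _ hx
    · intro hx
      obtain ⟨s, hs, k, -⟩ := h2 x hx x hx
      exact ⟨s, hs, k⟩
  have e2 : (tyInterp τ).con = P.con := by
    ext x y
    constructor
    · rintro ⟨s, hs, k⟩
      obtain ⟨m1, m2⟩ := (laws_simple s).con_mem _ _ k
      exact ((h1 s hs).con _ m1 _ m2).1 k
    · intro k
      obtain ⟨m1, m2⟩ := hP.con_mem _ _ k
      obtain ⟨s, hs, k1, k2⟩ := h2 x m1 y m2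
      exact ⟨s, hs, ((h1 s hs).con _ k1 _ k2).2 k⟩
  have e3 : (tyInterp τ).le = P.le := by
    ext x y
    constructor
    · rintro ⟨s, hs, k⟩
      obtain ⟨m1, m2⟩ := (laws_simple s).le_mem _ _ k
      exact ((h1 s hs).le _ m1 _ m2).1 k
    · intro k
      obtain ⟨m1, m2⟩ := hP.le_mem _ _ k
      obtain ⟨s, hs, k1, k2⟩ := h2 x m1 y m2
      exact ⟨s, hs, ((h1 s hs).le _ k1 _ k2).2 k⟩
  cases h : tyInterp τ
  cases P
  simp_all

theorem laws_ty (τ : TyExpr) : Laws (tyInterp τ) := by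
  constructor
  · rintro x y ⟨s, hs, k⟩
    obtain ⟨m1, m2⟩ := (laws_simple s).con_mem _ _ k
    exact ⟨⟨s, hs, m1⟩, ⟨s, hs, m2⟩⟩
  · rintro x y ⟨s, hs, k⟩
    obtain ⟨m1, m2⟩ := (laws_simple s).le_mem _ _ k
    exact ⟨⟨s, hs, m1⟩, ⟨s, hs, m2⟩⟩
  · rintro x ⟨s, hs, k⟩
    exact ⟨s, hs, (laws_simple s).le_refl _ k⟩
  · rintro x y z ⟨s, hs, k⟩ ⟨t, ht, l⟩
    obtain ⟨u, hu, h1, h2⟩ := unfolding_directed hs ht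
    obtain ⟨m1, m2⟩ := (laws_simple s).le_mem _ _ k
    obtain ⟨n1, n2⟩ := (laws_simple t).le_mem _ _ l
    exact ⟨u, hu, (laws_simple u).le_trans _ _ _ (((sub_of_pre h1).le _ m1 _ m2).1 k)
      (((sub_of_pre h2).le _ n1 _ n2).1 l)⟩
  · rintro x ⟨s, hs, k⟩
    exact ⟨s, hs, (laws_simple s).con_refl _ k⟩
  · rintro x y ⟨s, hs, k⟩
    exact ⟨s, hs, (laws_simple s).con_symm _ _ k⟩
  · rintro x y z ⟨s, hs, k⟩ ⟨t, ht, l⟩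
    obtain ⟨u, hu, h1, h2⟩ := unfolding_directed hs ht
    obtain ⟨m1, m2⟩ := (laws_simple s).le_mem _ _ k
    obtain ⟨n1, n2⟩ := (laws_simple t).con_mem _ _ l
    exact ⟨u, hu, (laws_simple u).con_down _ _ _ (((sub_of_pre h1).le _ m1 _ m2).1 k)
      (((sub_of_pre h2).con _ n1 _ n2).1 l)⟩

theorem tyInterp_void : tyInterp .void = voidP := by
  refine tyInterp_eq laws_void ?_ ?_
  · rintro s ⟨t, ht, hs⟩
    have : t = .void := by
      clear hs
      induction ht with
      | refl => rfl
      | tail _ h ih =>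
        subst ih
        cases h
    subst this
    cases hs
    exact sub_void _
  · rintro x hx; simp [voidP] at hx

theorem common_two {a : TyExpr} {x y : Pm} (hx : x ∈ (tyInterp a).carrier)
    (hy : y ∈ (tyInterp a).carrier) :
    ∃ s ∈ unfolding a, x ∈ (interpSimple s).carrier ∧ y ∈ (interpSimple s).carrier := by
  obtain ⟨s, hs, h⟩ := common_simple (τ := a) [x, y] (by simp [hx, hy])
  exact ⟨s, hs, h x (by simp), h y (by simp)⟩

theorem tyInterp_sum (a b : TyExpr) :
    tyInterp (.sum a b) = sumP (tyInterp a) (tyInterp b) := by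
  refine tyInterp_eq (laws_sum (laws_ty a) (laws_ty b)) ?_ ?_
  · intro s hs
    rcases mem_unfolding_sum.1 hs with rfl | ⟨x, hx, y, hy, rfl⟩
    · exact sub_void _
    · exact sub_sum (sub_tyInterp hx) (sub_tyInterp hy)
  · have key : ∀ x ∈ (sumP (tyInterp a) (tyInterp b)).carrier,
        ∃ s ∈ unfolding (.sum a b), x ∈ (interpSimple s).carrier := by
      rintro _ ((rfl | ⟨x, ⟨s, hs, hx⟩, rfl⟩) | (rfl | ⟨x, ⟨s, hs, hx⟩, rfl⟩))
      · exact ⟨_, mem_unfolding_sum.2 (.inr ⟨_, void_mem_unfolding _, _, void_mem_unfolding _, rfl⟩),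
          .inl (.inl rfl)⟩
      · exact ⟨_, mem_unfolding_sum.2 (.inr ⟨_, hs, _, void_mem_unfolding _, rfl⟩),
          .inl (.inr ⟨_, hx, rfl⟩)⟩
      · exact ⟨_, mem_unfolding_sum.2 (.inr ⟨_, void_mem_unfolding _, _, void_mem_unfolding _, rfl⟩),
          .inr (.inl rfl)⟩
      · exact ⟨_, mem_unfolding_sum.2 (.inr ⟨_, void_mem_unfolding _, _, hs, rfl⟩),
          .inr (.inr ⟨_, hx, rfl⟩)⟩
    intro x hx y hy
    exact common_two (key x hx) (key y hy)

theorem tyInterp_prod (a b : TyExpr) :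
    tyInterp (.prod a b) = prodP (tyInterp a) (tyInterp b) := by
  refine tyInterp_eq (laws_prod (laws_ty a) (laws_ty b)) ?_ ?_
  · intro s hs
    rcases mem_unfolding_prod.1 hs with rfl | ⟨x, hx, y, hy, rfl⟩
    · exact sub_void _
    · exact sub_prod (sub_tyInterp hx) (sub_tyInterp hy)
  · have key : ∀ x ∈ (prodP (tyInterp a) (tyInterp b)).carrier,
        ∃ s ∈ unfolding (.prod a b), x ∈ (interpSimple s).carrier := by
      rintro _ (⟨x, ⟨s, hs, hx⟩, rfl⟩ | ⟨x, ⟨s, hs, hx⟩, rfl⟩)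
      · exact ⟨_, mem_unfolding_prod.2 (.inr ⟨_, hs, _, void_mem_unfolding _, rfl⟩),
          .inl ⟨_, hx, rfl⟩⟩
      · exact ⟨_, mem_unfolding_prod.2 (.inr ⟨_, void_mem_unfolding _, _, hs, rfl⟩),
          .inr ⟨_, hx, rfl⟩⟩
    intro x hx y hy
    exact common_two (key x hx) (key y hy)

theorem tyInterp_arrow (a b : TyExpr) :
    tyInterp (.arrow a b) = funcP (tyInterp a) (tyInterp b) := by
  refine tyInterp_eq (laws_func (laws_ty a) (laws_ty b)) ?_ ?_
  · intro s hs
    rcases mem_unfolding_arrow.1 hs with rfl | ⟨x, hx, y, hy, rfl⟩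
    · exact sub_void _
    · exact sub_func (sub_tyInterp hx) (sub_tyInterp hy)
  · have key : ∀ x ∈ (funcP (tyInterp a) (tyInterp b)).carrier,
        ∃ s ∈ unfolding (.arrow a b), x ∈ (interpSimple s).carrier := by
      rintro _ ⟨X, c, rfl, hX, ⟨s, hs, hx⟩⟩
      obtain ⟨t, ht, h⟩ := common_simple X hX.1
      exact ⟨_, mem_unfolding_arrow.2 (.inr ⟨_, ht, _, hs, rfl⟩),
        ⟨X, c, rfl, ((sub_tyInterp ht).good h).2 hX, hx⟩⟩
    intro x hx y hy
    exact common_two (key x hx) (key y hy)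


/-! ### Elements and continuous functions -/

theorem elem_down {A : PData} (hA : Laws A) {X : List Pm} (h : ∀ x ∈ X, ∀ y ∈ X, A.con x y) :
    A.IsElem (downListP A X) := by
  refine ⟨?_, ?_, ?_⟩
  · rintro a ⟨x, hx, h⟩; exact (hA.le_mem _ _ h).1
  · rintro a b hab ⟨x, hx, h⟩; exact ⟨x, hx, hA.le_trans _ _ _ hab h⟩
  · rintro a ⟨x, hx, h1⟩ b ⟨y, hy, h2⟩
    exact hA.con_down _ _ _ h1 (hA.con_symm _ _ (hA.con_down _ _ _ h2 (h y hy x hx)))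

theorem elem_good {A : PData} (hA : Laws A) {X : List Pm} (h : goodList A X) :
    A.IsElem (downListP A X) :=
  elem_down hA fun x hx y hy => (h.2 x hx y hy).1

theorem down_subset {A : PData} {d : Set Pm} (hd : A.IsElem d) {X : List Pm}
    (h : ∀ x ∈ X, x ∈ d) : downListP A X ⊆ d := by
  rintro a ⟨x, hx, k⟩; exact hd.2.1 _ _ k (h x hx)

theorem subset_down {A : PData} (hA : Laws A) {X : List Pm} (h : ∀ x ∈ X, x ∈ A.carrier) :
    ∀ x ∈ X, x ∈ downListP A X := fun x hx => ⟨x, hx, hA.le_refl _ (h x hx)⟩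

theorem exists_good {A : PData} (hA : Laws A) (Z : List Pm)
    (hc : ∀ x ∈ Z, ∀ y ∈ Z, A.con x y) :
    ∃ X, goodList A X ∧ (∀ x ∈ X, x ∈ Z) ∧ ∀ z ∈ Z, ∃ x ∈ X, A.le z x := by
  classical
  induction Z with
  | nil => exact ⟨[], ⟨by simp, by simp⟩, by simp, by simp⟩
  | cons z Z ih =>
    obtain ⟨X, h1, h2, h3⟩ := ih fun x hx y hy =>
      hc x (List.mem_cons_of_mem _ hx) y (List.mem_cons_of_mem _ hy)
    have hz : z ∈ A.carrier := (hA.con_mem _ _ (hc z List.mem_cons_self z List.mem_cons_self)).1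
    by_cases hzX : ∃ x ∈ X, A.le z x
    · refine ⟨X, h1, fun x hx => List.mem_cons_of_mem _ (h2 x hx), fun w hw => ?_⟩
      rcases List.mem_cons.1 hw with rfl | hw
      · exact hzX
      · exact h3 w hw
    · have hsub : ∀ x ∈ z :: X.filter (fun x => ¬ A.le x z), x ∈ z :: Z := by
        intro x hx
        rcases List.mem_cons.1 hx with rfl | hx
        · exact List.mem_cons_self
        · exact List.mem_cons_of_mem _ (h2 x (List.mem_of_mem_filter hx))
      refine ⟨z :: X.filter (fun x => ¬ A.le x z), ⟨?_, ?_⟩, hsub, ?_⟩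
      · intro x hx
        exact (hA.con_mem _ _ (hc x (hsub x hx) x (hsub x hx))).1
      · intro x hx y hy
        refine ⟨hc x (hsub x hx) y (hsub y hy), fun hxy => ?_⟩
        rcases List.mem_cons.1 hx with rfl | hx <;> rcases List.mem_cons.1 hy with rfl | hy
        · rfl
        · exact absurd ⟨y, List.mem_of_mem_filter hy, hxy⟩ hzX
        · exact absurd hxy (by simpa using (List.mem_filter.1 hx).2)
        · exact (h1.2 x (List.mem_of_mem_filter hx) y (List.mem_of_mem_filter hy)).2 hxy
      · intro w hw
        rcases List.mem_cons.1 hw with rfl | hw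
        · exact ⟨w, List.mem_cons_self, hA.le_refl _ hz⟩
        · obtain ⟨x, hx, hwx⟩ := h3 w hw
          by_cases hxz : A.le x z
          · exact ⟨z, List.mem_cons_self, hA.le_trans _ _ _ hwx hxz⟩
          · exact ⟨x, List.mem_cons_of_mem _ (List.mem_filter.2 ⟨hx, by simpa using hxz⟩), hwx⟩

/-- Continuity of a function on sets of primes. -/
structure Cont (f : Set Pm → Set Pm) : Prop where
  mono : ∀ d e, d ⊆ e → f d ⊆ f e
  fin : ∀ d b, b ∈ f d → ∃ Z : List Pm, (∀ z ∈ Z, z ∈ d) ∧ b ∈ f {z | z ∈ Z}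

theorem aps_PrOf {A : PData} (hA : Laws A) {d : Set Pm} (hd : A.IsElem d)
    {f : Set Pm → Set Pm} (hf : Cont f) : aps (PrOf A f) d = f d := by
  ext b
  constructor
  · rintro ⟨X, hX, X', b', e, hg, hb⟩
    cases e
    exact hf.mono _ _ (down_subset hd hX) hb
  · intro hb
    obtain ⟨Z, hZ, hbZ⟩ := hf.fin d b hb
    obtain ⟨X, h1, h2, h3⟩ := exists_good hA Z fun x hx y hy => hd.2.2 x (hZ x hx) y (hZ y hy)
    exact ⟨X, fun x hx => hZ x (h2 x hx), X, b, rfl, h1, hf.mono _ _ (fun z hz => h3 z hz) hbZ⟩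

theorem PrOf_elem {A B : PData} (hA : Laws A) {f : Set Pm → Set Pm} (hf : Cont f)
    (h : ∀ d, A.IsElem d → B.IsElem (f d)) : (funcP A B).IsElem (PrOf A f) := by
  refine ⟨?_, ?_, ?_⟩
  · rintro _ ⟨X, a, rfl, hg, ha⟩
    exact ⟨X, a, rfl, hg, (h _ (elem_good hA hg)).1 ha⟩
  · rintro _ _ ⟨X, a, Y, b, rfl, rfl, h1, h2, h3, h4, h5, h6⟩ ⟨Y', b', e, hg, hb⟩
    cases e
    refine ⟨X, a, rfl, h1, (h _ (elem_good hA h1)).2.1 _ _ h6 (hf.mono _ _ ?_ hb)⟩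
    exact down_subset (elem_good hA h1) h5
  · rintro _ ⟨X, a, rfl, hX, ha⟩ _ ⟨Y, b, rfl, hY, hb⟩
    refine ⟨X, a, Y, b, rfl, rfl, hX, (h _ (elem_good hA hX)).1 ha, hY,
      (h _ (elem_good hA hY)).1 hb, fun hc => ?_⟩
    have he : A.IsElem (downListP A (X ++ Y)) := by
      refine elem_down hA fun x hx y hy => ?_
      rcases List.mem_append.1 hx with hx | hx <;> rcases List.mem_append.1 hy with hy | hy
      · exact (hX.2 x hx y hy).1
      · exact hc x hx y hy
      · exact hA.con_symm _ _ (hc y hy x hx)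
      · exact (hY.2 x hx y hy).1
    refine (h _ he).2.2 a (hf.mono _ _ ?_ ha) b (hf.mono _ _ ?_ hb)
    · rintro u ⟨x, hx, k⟩; exact ⟨x, List.mem_append_left _ hx, k⟩
    · rintro u ⟨x, hx, k⟩; exact ⟨x, List.mem_append_right _ hx, k⟩

theorem fn_mem_iff {A B : PData} (hA : Laws A) (hB : Laws B) {r : Set Pm}
    (hr : (funcP A B).IsElem r) {X : List Pm} (hX : goodList A X) (b : Pm) :
    Pm.fn X b ∈ r ↔ b ∈ aps r (downListP A X) := by
  constructor
  · intro h; exact ⟨X, subset_down hA hX.1, h⟩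
  · rintro ⟨Y, hY, h⟩
    obtain ⟨Y', b', e, hg, hb⟩ := hr.1 h
    cases e
    exact hr.2.1 _ _ ⟨X, b, Y, b, rfl, rfl, hX, hb, hg, hb, hY, hB.le_refl _ hb⟩ h

theorem aps_elem {A B : PData} (hA : Laws A) (hB : Laws B) {r d : Set Pm}
    (hr : (funcP A B).IsElem r) (hd : A.IsElem d) : B.IsElem (aps r d) := by
  refine ⟨?_, ?_, ?_⟩
  · rintro b ⟨X, hX, h⟩
    obtain ⟨Y', b', e, hg, hb⟩ := hr.1 h
    cases e
    exact hb
  · rintro a b hab ⟨X, hX, h⟩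
    obtain ⟨Y', b', e, hg, hb⟩ := hr.1 h
    cases e
    exact ⟨X, hX, hr.2.1 _ _ ⟨X, a, X, b, rfl, rfl, hg, (hB.le_mem _ _ hab).1, hg, hb,
      fun v hv => ⟨v, hv, hA.le_refl _ (hg.1 v hv)⟩, hab⟩ h⟩
  · rintro a ⟨X, hX, h⟩ b ⟨Y, hY, h'⟩
    obtain ⟨X', a', Y', b', e, e', -, -, -, -, k⟩ := hr.2.2 _ h _ h'
    cases e; cases e'
    exact k fun u hu v hv => hd.2.2 u (hX u hu) v (hY v hv)

theorem elem_ext {A B : PData} (hA : Laws A) (hB : Laws B) {r r' : Set Pm}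
    (hr : (funcP A B).IsElem r) (hr' : (funcP A B).IsElem r')
    (h : ∀ d, A.IsElem d → aps r d = aps r' d) : r = r' := by
  ext p
  constructor
  · intro hp
    obtain ⟨X, b, rfl, hg, hb⟩ := hr.1 hp
    rw [fn_mem_iff hA hB hr hg, h _ (elem_good hA hg)] at hp
    rwa [fn_mem_iff hA hB hr' hg]
  · intro hp
    obtain ⟨X, b, rfl, hg, hb⟩ := hr'.1 hp
    rw [fn_mem_iff hA hB hr' hg, ← h _ (elem_good hA hg)] at hp
    rwa [fn_mem_iff hA hB hr hg]

theorem elem_empty (A : PData) : A.IsElem ∅ := by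
  refine ⟨?_, ?_, ?_⟩ <;> simp

/-! ### Continuity of the semantics -/

theorem aps_mono {r r' d d' : Set Pm} (h : r ⊆ r') (h' : d ⊆ d') : aps r d ⊆ aps r' d' := by
  rintro b ⟨X, hX, hb⟩; exact ⟨X, fun x hx => h' (hX x hx), h hb⟩

theorem sem_mono (M : Tm) : ∀ (ε ε' : Env), (∀ n, ε n ⊆ ε' n) → sem M ε ⊆ sem M ε' := by
  induction M with
  | var n => intro ε ε' h; exact h n
  | const c => intro ε ε' h; exact fun _ h => h
  | app M N ihM ihN => intro ε ε' h; exact aps_mono (ihM _ _ h) (ihN _ _ h)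
  | lam σ M ih =>
    rintro ε ε' h _ ⟨X, a, rfl, hg, ha⟩
    refine ⟨X, a, rfl, hg, ih _ _ ?_ ha⟩
    intro n
    cases n with
    | zero => exact fun _ h => h
    | succ n => exact h n

/-- The environment given by a finite list of (variable, prime) pairs. -/
def listEnv (L : List (ℕ × Pm)) : Env := fun n => {a | (n, a) ∈ L}

theorem sem_fin (M : Tm) : ∀ (ε : Env) (b : Pm), b ∈ sem M ε →
    ∃ L : List (ℕ × Pm), (∀ p ∈ L, p.2 ∈ ε p.1) ∧ b ∈ sem M (listEnv L) := by
  induction M with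
  | var n =>
    intro ε b hb
    exact ⟨[(n, b)], by simpa using (show b ∈ ε n from hb), by simp [sem, listEnv]⟩
  | const c => intro ε b hb; exact ⟨[], by simp, hb⟩
  | app M N ihM ihN =>
    rintro ε b ⟨X, hX, hb⟩
    obtain ⟨L, hL, hbL⟩ := ihM _ _ hb
    have : ∃ L' : List (ℕ × Pm), (∀ p ∈ L', p.2 ∈ ε p.1) ∧ ∀ x ∈ X, x ∈ sem N (listEnv L') := by
      clear hb hbL
      induction X with
      | nil => exact ⟨[], by simp, by simp⟩
      | cons x X ih =>
        obtain ⟨L1, h1, h2⟩ := ih fun y hy => hX y (List.mem_cons_of_mem _ hy)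
        obtain ⟨L2, h3, h4⟩ := ihN _ _ (hX x List.mem_cons_self)
        refine ⟨L1 ++ L2, ?_, ?_⟩
        · intro p hp
          rcases List.mem_append.1 hp with hp | hp
          · exact h1 p hp
          · exact h3 p hp
        · intro y hy
          rcases List.mem_cons.1 hy with rfl | hy
          · exact sem_mono N _ _ (fun n a ha => List.mem_append_right _ ha) h4
          · exact sem_mono N _ _ (fun n a ha => List.mem_append_left _ ha) (h2 y hy)
    obtain ⟨L', hL', hXL⟩ := this
    refine ⟨L ++ L', ?_, X, fun x hx => ?_, ?_⟩
    · intro p hp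
      rcases List.mem_append.1 hp with hp | hp
      · exact hL p hp
      · exact hL' p hp
    · exact sem_mono N _ _ (fun n a ha => List.mem_append_right _ ha) (hXL x hx)
    · exact sem_mono M _ _ (fun n a ha => List.mem_append_left _ ha) hbL
  | lam σ M ih =>
    rintro ε _ ⟨X, a, rfl, hg, ha⟩
    obtain ⟨L, hL, haL⟩ := ih _ _ ha
    refine ⟨L.filterMap (fun p => match p with
      | (0, _) => none
      | (n + 1, a) => some (n, a)), ?_, X, a, rfl, hg, sem_mono M _ _ ?_ haL⟩
    · intro p hp
      obtain ⟨⟨n, q⟩, hq, e⟩ := List.mem_filterMap.1 hp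
      cases n with
      | zero => simp at e
      | succ n =>
        simp at e
        subst e
        exact hL _ hq
    · intro n q hq
      cases n with
      | zero => exact hL _ hq
      | succ n => exact List.mem_filterMap.2 ⟨(n + 1, q), hq, rfl⟩

theorem cont_body (M : Tm) (ε : Env) : Cont fun d => sem M (envCons d ε) := by
  constructor
  · intro d e h
    refine sem_mono M _ _ fun n => ?_
    cases n with
    | zero => exact h
    | succ n => exact fun _ h => h
  · intro d b hb
    obtain ⟨L, hL, hbL⟩ := sem_fin M _ _ hb
    refine ⟨L.filterMap (fun p => match p with
      | (0, a) => some a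
      | (_ + 1, _) => none), ?_, sem_mono M _ _ ?_ hbL⟩
    · intro q hq
      obtain ⟨⟨n, q'⟩, hq', e⟩ := List.mem_filterMap.1 hq
      cases n with
      | zero =>
        simp at e
        subst e
        exact hL _ hq'
      | succ n => simp at e
    · intro n q hq
      cases n with
      | zero => exact List.mem_filterMap.2 ⟨(0, q), hq, rfl⟩
      | succ n => exact hL _ hq

theorem cont_PrOf {B : PData} {g : Set Pm → Set Pm → Set Pm}
    (h : ∀ e, Cont fun d => g d e) : Cont fun d => PrOf B (g d) := by
  constructor
  · rintro d e hde _ ⟨X, a, rfl, hg, ha⟩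
    exact ⟨X, a, rfl, hg, (h _).mono _ _ hde ha⟩
  · rintro d _ ⟨X, a, rfl, hg, ha⟩
    obtain ⟨Z, hZ, h'⟩ := (h _).fin _ _ ha
    exact ⟨Z, hZ, X, a, rfl, hg, h'⟩

theorem cont_inj0 : Cont inj0 := by
  constructor
  · rintro d e h _ (rfl | ⟨a, ha, rfl⟩)
    · exact .inl rfl
    · exact .inr ⟨a, h ha, rfl⟩
  · rintro d _ (rfl | ⟨a, ha, rfl⟩)
    · exact ⟨[], by simp, .inl rfl⟩
    · exact ⟨[a], by simpa using ha, .inr ⟨a, by simp, rfl⟩⟩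

theorem cont_inj1 : Cont inj1 := by
  constructor
  · rintro d e h _ (rfl | ⟨a, ha, rfl⟩)
    · exact .inl rfl
    · exact .inr ⟨a, h ha, rfl⟩
  · rintro d _ (rfl | ⟨a, ha, rfl⟩)
    · exact ⟨[], by simp, .inl rfl⟩
    · exact ⟨[a], by simpa using ha, .inr ⟨a, by simp, rfl⟩⟩

theorem cont_fst : Cont fstS := by
  constructor
  · intro d e h a ha; exact h ha
  · intro d a ha; exact ⟨[.ppr false a], by simpa using (show Pm.ppr false a ∈ d from ha), by simp [fstS]⟩

theorem cont_snd : Cont sndS := by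
  constructor
  · intro d e h a ha; exact h ha
  · intro d a ha; exact ⟨[.ppr true a], by simpa using (show Pm.ppr true a ∈ d from ha), by simp [sndS]⟩

theorem cont_pair1 (e : Set Pm) : Cont fun d => pairS d e := by
  constructor
  · rintro d d' h _ (⟨a, ha, rfl⟩ | ⟨a, ha, rfl⟩)
    · exact .inl ⟨a, h ha, rfl⟩
    · exact .inr ⟨a, ha, rfl⟩
  · rintro d _ (⟨a, ha, rfl⟩ | ⟨a, ha, rfl⟩)
    · exact ⟨[a], by simpa using ha, .inl ⟨a, by simp, rfl⟩⟩
    · exact ⟨[], by simp, .inr ⟨a, ha, rfl⟩⟩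

theorem cont_pair2 (d : Set Pm) : Cont fun e => pairS d e := by
  constructor
  · rintro d d' h _ (⟨a, ha, rfl⟩ | ⟨a, ha, rfl⟩)
    · exact .inl ⟨a, ha, rfl⟩
    · exact .inr ⟨a, h ha, rfl⟩
  · rintro d _ (⟨a, ha, rfl⟩ | ⟨a, ha, rfl⟩)
    · exact ⟨[], by simp, .inl ⟨a, ha, rfl⟩⟩
    · exact ⟨[a], by simpa using ha, .inr ⟨a, by simp, rfl⟩⟩

theorem cont_case1 (f g : Set Pm) : Cont fun d => caseS d f g := by
  constructor
  · rintro d d' h b (⟨h1, X, hX, hb⟩ | ⟨h1, X, hX, hb⟩)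
    · exact .inl ⟨h h1, X, fun x hx => h (hX x hx), hb⟩
    · exact .inr ⟨h h1, X, fun x hx => h (hX x hx), hb⟩
  · rintro d b (⟨h1, X, hX, hb⟩ | ⟨h1, X, hX, hb⟩)
    · refine ⟨.stag false :: X.map (Pm.spr false), ?_, .inl ⟨by simp, X, fun x hx => ?_, hb⟩⟩
      · simpa [h1] using (show ∀ x ∈ X, Pm.spr false x ∈ d from hX)
      · simpa [prj0] using hx
    · refine ⟨.stag true :: X.map (Pm.spr true), ?_, .inr ⟨by simp, X, fun x hx => ?_, hb⟩⟩
      · simpa [h1] using (show ∀ x ∈ X, Pm.spr true x ∈ d from hX)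
      · simpa [prj1] using hx

theorem cont_case2 (d g : Set Pm) : Cont fun f => caseS d f g := by
  constructor
  · rintro f f' h b (⟨h1, X, hX, hb⟩ | ⟨h1, X, hX, hb⟩)
    · exact .inl ⟨h1, X, hX, h hb⟩
    · exact .inr ⟨h1, X, hX, hb⟩
  · rintro f b (⟨h1, X, hX, hb⟩ | ⟨h1, X, hX, hb⟩)
    · exact ⟨[.fn X b], by simpa using hb, .inl ⟨h1, X, hX, by simp⟩⟩
    · exact ⟨[], by simp, .inr ⟨h1, X, hX, hb⟩⟩

theorem cont_case3 (d f : Set Pm) : Cont fun g => caseS d f g := by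
  constructor
  · rintro f f' h b (⟨h1, X, hX, hb⟩ | ⟨h1, X, hX, hb⟩)
    · exact .inl ⟨h1, X, hX, hb⟩
    · exact .inr ⟨h1, X, hX, h hb⟩
  · rintro f b (⟨h1, X, hX, hb⟩ | ⟨h1, X, hX, hb⟩)
    · exact ⟨[], by simp, .inl ⟨h1, X, hX, hb⟩⟩
    · exact ⟨[.fn X b], by simpa using hb, .inr ⟨h1, X, hX, by simp⟩⟩

theorem cont_pcase1 (b c : Set Pm) : Cont fun a => pcaseS a b c := by
  constructor
  · rintro a a' h p (⟨h1, h2, h3, h4⟩ | ⟨h1, h2⟩ | ⟨h1, h2⟩)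
    · by_cases k1 : Pm.stag false ∈ a'
      · exact .inr (.inl ⟨k1, h3⟩)
      · by_cases k2 : Pm.stag true ∈ a'
        · exact .inr (.inr ⟨k2, h4⟩)
        · exact .inl ⟨k1, k2, h3, h4⟩
    · exact .inr (.inl ⟨h h1, h2⟩)
    · exact .inr (.inr ⟨h h1, h2⟩)
  · rintro a p (⟨h1, h2, h3, h4⟩ | ⟨h1, h2⟩ | ⟨h1, h2⟩)
    · exact ⟨[], by simp, .inl ⟨by simp, by simp, h3, h4⟩⟩
    · exact ⟨[.stag false], by simpa using h1, .inr (.inl ⟨by simp, h2⟩)⟩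
    · exact ⟨[.stag true], by simpa using h1, .inr (.inr ⟨by simp, h2⟩)⟩

theorem cont_pcase2 (a c : Set Pm) : Cont fun b => pcaseS a b c := by
  constructor
  · rintro b b' h p (⟨h1, h2, h3, h4⟩ | ⟨h1, h2⟩ | ⟨h1, h2⟩)
    · exact .inl ⟨h1, h2, h h3, h4⟩
    · exact .inr (.inl ⟨h1, h h2⟩)
    · exact .inr (.inr ⟨h1, h2⟩)
  · rintro b p (⟨h1, h2, h3, h4⟩ | ⟨h1, h2⟩ | ⟨h1, h2⟩)
    · exact ⟨[p], by simpa using h3, .inl ⟨h1, h2, by simp, h4⟩⟩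
    · exact ⟨[p], by simpa using h2, .inr (.inl ⟨h1, by simp⟩)⟩
    · exact ⟨[], by simp, .inr (.inr ⟨h1, h2⟩)⟩

theorem cont_pcase3 (a b : Set Pm) : Cont fun c => pcaseS a b c := by
  constructor
  · rintro b b' h p (⟨h1, h2, h3, h4⟩ | ⟨h1, h2⟩ | ⟨h1, h2⟩)
    · exact .inl ⟨h1, h2, h3, h h4⟩
    · exact .inr (.inl ⟨h1, h2⟩)
    · exact .inr (.inr ⟨h1, h h2⟩)
  · rintro b p (⟨h1, h2, h3, h4⟩ | ⟨h1, h2⟩ | ⟨h1, h2⟩)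
    · exact ⟨[p], by simpa using h4, .inl ⟨h1, h2, h3, by simp⟩⟩
    · exact ⟨[], by simp, .inr (.inl ⟨h1, h2⟩)⟩
    · exact ⟨[p], by simpa using h2, .inr (.inr ⟨h1, by simp⟩)⟩

/-! ### Semantics of applied constants -/

/-- `d` is an element of the domain of `σ`. -/
def El (σ : TyExpr) (d : Set Pm) : Prop := (tyInterp σ).IsElem d

theorem aps_ty {σ : TyExpr} {d : Set Pm} (hd : El σ d) {f : Set Pm → Set Pm} (hf : Cont f) :
    aps (PrOf (tyInterp σ) f) d = f d := aps_PrOf (laws_ty σ) hd hf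

theorem El.aps {σ τ : TyExpr} {r d : Set Pm} (hr : El (.arrow σ τ) r) (hd : El σ d) :
    El τ (aps r d) := by
  rw [El, tyInterp_arrow] at hr
  exact aps_elem (laws_ty _) (laws_ty _) hr hd

theorem sem_zero {σ τ : TyExpr} {M : Tm} {ε : Env} (h : El σ (sem M ε)) :
    sem (.app (.const (.czero σ τ)) M) ε = inj0 (sem M ε) := aps_ty h cont_inj0

theorem sem_one {σ τ : TyExpr} {M : Tm} {ε : Env} (h : El τ (sem M ε)) :
    sem (.app (.const (.cone σ τ)) M) ε = inj1 (sem M ε) := aps_ty h cont_inj1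

theorem sem_fst {σ τ : TyExpr} {M : Tm} {ε : Env} (h : El (.prod σ τ) (sem M ε)) :
    sem (.app (.const (.cfst σ τ)) M) ε = fstS (sem M ε) := aps_ty h cont_fst

theorem sem_snd {σ τ : TyExpr} {M : Tm} {ε : Env} (h : El (.prod σ τ) (sem M ε)) :
    sem (.app (.const (.csnd σ τ)) M) ε = sndS (sem M ε) := aps_ty h cont_snd

theorem sem_pair {σ τ : TyExpr} {M N : Tm} {ε : Env} (h : El σ (sem M ε)) (h' : El τ (sem N ε)) :
    sem (.app (.app (.const (.cpair σ τ)) M) N) ε = pairS (sem M ε) (sem N ε) := by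
  simp only [sem, constSem]
  rw [aps_ty h (cont_PrOf fun e => cont_pair1 e), aps_ty h' (cont_pair2 _)]

theorem sem_case {σ τ ρ : TyExpr} {M N P : Tm} {ε : Env} (h : El (.sum σ τ) (sem M ε))
    (h' : El (.arrow σ ρ) (sem N ε)) (h'' : El (.arrow τ ρ) (sem P ε)) :
    sem (.app (.app (.app (.const (.ccase σ τ ρ)) M) N) P) ε
      = caseS (sem M ε) (sem N ε) (sem P ε) := by
  simp only [sem, constSem]
  rw [aps_ty h (cont_PrOf fun e => cont_PrOf fun e' => cont_case1 e e'),
    aps_ty h' (cont_PrOf fun e => cont_case2 _ e), aps_ty h'' (cont_case3 _ _)]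

theorem sem_pcase {σ τ ρ : TyExpr} {M N P : Tm} {ε : Env} (h : El (.sum σ τ) (sem M ε))
    (h' : El ρ (sem N ε)) (h'' : El ρ (sem P ε)) :
    sem (.app (.app (.app (.const (.cpcase σ τ ρ)) M) N) P) ε
      = pcaseS (sem M ε) (sem N ε) (sem P ε) := by
  simp only [sem, constSem]
  rw [aps_ty h (cont_PrOf fun e => cont_PrOf fun e' => cont_pcase1 e e'),
    aps_ty h' (cont_PrOf fun e => cont_pcase2 _ e), aps_ty h'' (cont_pcase3 _ _)]


/-! ### Definable elements and functions -/

/-- The type of booleans. -/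
def tyB : TyExpr := .sum .void .void

/-- `d` is the denotation of a closed term of type `σ`. -/
def Definable (σ : TyExpr) (d : Set Pm) : Prop :=
  ∃ M : Tm, (∀ Γ, HasType Γ M σ) ∧ (∀ ε, sem M ε = d) ∧ El σ d

/-- `f` is definable by a term with one free variable. -/
def Fun (σ τ : TyExpr) (f : Set Pm → Set Pm) : Prop :=
  ∃ B : Tm, (∀ Γ, HasType (σ :: Γ) B τ) ∧ (∀ x, El σ x → ∀ ε, sem B (envCons x ε) = f x) ∧
    ∀ x, El σ x → El τ (f x)

theorem Fun.toDef {σ τ : TyExpr} {f : Set Pm → Set Pm} (h : Fun σ τ f) :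
    ∃ r, Definable (.arrow σ τ) r ∧ ∀ x, El σ x → aps r x = f x := by
  obtain ⟨B, h1, h2, h3⟩ := h
  have key : ∀ ε, sem (.lam σ B) ε = PrOf (tyInterp σ) fun d => sem B (envCons d botEnv) := by
    intro ε
    ext p
    constructor
    · rintro ⟨X, a, rfl, hg, ha⟩
      refine ⟨X, a, rfl, hg, ?_⟩
      have e := h2 _ (elem_good (laws_ty σ) hg)
      exact ((e ε).trans (e botEnv).symm).subset ha
    · rintro ⟨X, a, rfl, hg, ha⟩
      refine ⟨X, a, rfl, hg, ?_⟩
      have e := h2 _ (elem_good (laws_ty σ) hg)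
      exact ((e botEnv).trans (e ε).symm).subset ha
  refine ⟨_, ⟨.lam σ B, fun Γ => .lam (h1 Γ), key, ?_⟩, ?_⟩
  · rw [El, tyInterp_arrow]
    refine PrOf_elem (laws_ty σ) (cont_body B _) fun d hd => ?_
    rw [h2 d hd]
    exact h3 d hd
  · intro x hx
    rw [aps_ty hx (cont_body B _), h2 x hx]

theorem Definable.fun {σ τ : TyExpr} {r : Set Pm} (h : Definable (.arrow σ τ) r) :
    Fun σ τ (aps r) := by
  obtain ⟨M, h1, h2, h3⟩ := h
  refine ⟨.app M (.var 0), fun Γ => .app (h1 _) (.var rfl), fun x hx ε => ?_, fun x hx => h3.aps hx⟩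
  simp only [sem, h2]
  rfl

theorem Fun.congr {σ τ : TyExpr} {f g : Set Pm → Set Pm} (h : Fun σ τ f)
    (e : ∀ x, El σ x → g x = f x) : Fun σ τ g := by
  obtain ⟨B, h1, h2, h3⟩ := h
  exact ⟨B, h1, fun x hx ε => by rw [h2 x hx, e x hx], fun x hx => by rw [e x hx]; exact h3 x hx⟩

theorem Fun.id (σ : TyExpr) : Fun σ σ fun x => x :=
  ⟨.var 0, fun Γ => .var rfl, fun x hx ε => rfl, fun x hx => hx⟩

theorem Definable.const {σ τ : TyExpr} {d : Set Pm} (h : Definable τ d) : Fun σ τ fun _ => d := by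
  obtain ⟨M, h1, h2, h3⟩ := h
  exact ⟨M, fun Γ => h1 _, fun x hx ε => h2 _, fun x hx => h3⟩

theorem Fun.app {σ τ ρ : TyExpr} {f g : Set Pm → Set Pm} (hf : Fun σ (.arrow τ ρ) f)
    (hg : Fun σ τ g) : Fun σ ρ fun x => aps (f x) (g x) := by
  obtain ⟨B, h1, h2, h3⟩ := hf
  obtain ⟨C, k1, k2, k3⟩ := hg
  refine ⟨.app B C, fun Γ => .app (h1 _) (k1 _), fun x hx ε => ?_, fun x hx => (h3 x hx).aps (k3 x hx)⟩
  simp only [sem, h2 x hx, k2 x hx]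

theorem Fun.comp {σ τ ρ : TyExpr} {f g : Set Pm → Set Pm} (hf : Fun τ ρ f)
    (hg : Fun σ τ g) : Fun σ ρ fun x => f (g x) := by
  obtain ⟨r, hr, h⟩ := hf.toDef
  refine (Fun.app hr.const hg).congr fun x hx => ?_
  obtain ⟨C, k1, k2, k3⟩ := hg
  rw [h _ (k3 x hx)]

theorem El_empty (σ : TyExpr) : El σ ∅ := elem_empty _

theorem def_empty (σ : TyExpr) : Definable σ ∅ :=
  ⟨.const (.comega σ), fun Γ => .const (.comega σ), fun ε => rfl, El_empty σ⟩

/-! ### Sums -/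

theorem El_inj0 {a b : TyExpr} {d : Set Pm} (h : El a d) : El (.sum a b) (inj0 d) := by
  rw [El, tyInterp_sum]
  refine ⟨?_, ?_, ?_⟩
  · rintro _ (rfl | ⟨c, hc, rfl⟩)
    · exact .inl (.inl rfl)
    · exact .inl (.inr ⟨c, h.1 hc, rfl⟩)
  · rintro x y (⟨rfl, -⟩ | ⟨rfl, k⟩ | ⟨u, v, rfl, rfl, k⟩ | ⟨u, v, rfl, rfl, k⟩) hy
    · exact .inl rfl
    · rcases hy with rfl | ⟨c, hc, rfl⟩ <;> simp [sumSideP] at k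
    · rcases hy with hy | ⟨c, hc, hy⟩
      · cases hy
      · cases hy
        exact .inr ⟨u, h.2.1 _ _ k hc, rfl⟩
    · rcases hy with hy | ⟨c, hc, hy⟩ <;> cases hy
  · intro x hx y hy
    have side : ∀ z ∈ inj0 d, z ∈ sumSideP (tyInterp a) false := by
      rintro _ (rfl | ⟨c, hc, rfl⟩)
      · exact .inl rfl
      · exact .inr ⟨c, h.1 hc, rfl⟩
    refine .inl ⟨side x hx, side y hy, ?_⟩
    rintro u v rfl rfl
    rcases hx with hx | ⟨c, hc, hx⟩ <;> cases hx
    rcases hy with hy | ⟨c', hc', hy⟩ <;> cases hy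
    exact h.2.2 _ hc _ hc'

theorem El_inj1 {a b : TyExpr} {d : Set Pm} (h : El b d) : El (.sum a b) (inj1 d) := by
  rw [El, tyInterp_sum]
  refine ⟨?_, ?_, ?_⟩
  · rintro _ (rfl | ⟨c, hc, rfl⟩)
    · exact .inr (.inl rfl)
    · exact .inr (.inr ⟨c, h.1 hc, rfl⟩)
  · rintro x y (⟨rfl, k⟩ | ⟨rfl, -⟩ | ⟨u, v, rfl, rfl, k⟩ | ⟨u, v, rfl, rfl, k⟩) hy
    · rcases hy with rfl | ⟨c, hc, rfl⟩ <;> simp [sumSideP] at k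
    · exact .inl rfl
    · rcases hy with hy | ⟨c, hc, hy⟩ <;> cases hy
    · rcases hy with hy | ⟨c, hc, hy⟩
      · cases hy
      · cases hy
        exact .inr ⟨u, h.2.1 _ _ k hc, rfl⟩
  · intro x hx y hy
    have side : ∀ z ∈ inj1 d, z ∈ sumSideP (tyInterp b) true := by
      rintro _ (rfl | ⟨c, hc, rfl⟩)
      · exact .inl rfl
      · exact .inr ⟨c, h.1 hc, rfl⟩
    refine .inr ⟨side x hx, side y hy, ?_⟩
    rintro u v rfl rfl
    rcases hx with hx | ⟨c, hc, hx⟩ <;> cases hx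
    rcases hy with hy | ⟨c', hc', hy⟩ <;> cases hy
    exact h.2.2 _ hc _ hc'

theorem El_sum_cases {a b : TyExpr} {x : Set Pm} (h : El (.sum a b) x) :
    x = ∅ ∨ (∃ e, El a e ∧ x = inj0 e) ∨ ∃ e, El b e ∧ x = inj1 e := by
  rw [El, tyInterp_sum] at h
  obtain ⟨h1, h2, h3⟩ := h
  have la := laws_ty a
  have lb := laws_ty b
  rcases x.eq_empty_or_nonempty with rfl | ⟨p, hp⟩
  · exact .inl rfl
  · rcases h1 hp with hs | hs
    · refine .inr (.inl ⟨prj0 x, ⟨?_, ?_, ?_⟩, ?_⟩)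
      · intro u hu
        rcases h1 hu with (k | ⟨c, hc, k⟩) | (k | ⟨c, hc, k⟩) <;> cases k
        exact hc
      · intro u v huv hv
        exact h2 _ _ (.inr (.inr (.inl ⟨u, v, rfl, rfl, huv⟩))) hv
      · intro u hu v hv
        rcases h3 _ hu _ hv with ⟨-, -, k⟩ | ⟨k, -⟩
        · exact k u v rfl rfl
        · rcases k with k | ⟨c, hc, k⟩ <;> cases k
      · have ht : Pm.stag false ∈ x := h2 _ _ (.inl ⟨rfl, hs⟩) hp
        ext q
        constructor
        · intro hq
          rcases h3 _ ht _ hq with ⟨-, k, -⟩ | ⟨k, -⟩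
          · rcases k with rfl | ⟨c, hc, rfl⟩
            · exact .inl rfl
            · exact .inr ⟨c, hq, rfl⟩
          · rcases k with k | ⟨c, hc, k⟩ <;> cases k
        · rintro (rfl | ⟨c, hc, rfl⟩)
          · exact ht
          · exact hc
    · refine .inr (.inr ⟨prj1 x, ⟨?_, ?_, ?_⟩, ?_⟩)
      · intro u hu
        rcases h1 hu with (k | ⟨c, hc, k⟩) | (k | ⟨c, hc, k⟩) <;> cases k
        exact hc
      · intro u v huv hv
        exact h2 _ _ (.inr (.inr (.inr ⟨u, v, rfl, rfl, huv⟩))) hv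
      · intro u hu v hv
        rcases h3 _ hu _ hv with ⟨k, -⟩ | ⟨-, -, k⟩
        · rcases k with k | ⟨c, hc, k⟩ <;> cases k
        · exact k u v rfl rfl
      · have ht : Pm.stag true ∈ x := h2 _ _ (.inr (.inl ⟨rfl, hs⟩)) hp
        ext q
        constructor
        · intro hq
          rcases h3 _ ht _ hq with ⟨k, -⟩ | ⟨-, k, -⟩
          · rcases k with k | ⟨c, hc, k⟩ <;> cases k
          · rcases k with rfl | ⟨c, hc, rfl⟩
            · exact .inl rfl
            · exact .inr ⟨c, hq, rfl⟩
        · rintro (rfl | ⟨c, hc, rfl⟩)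
          · exact ht
          · exact hc

theorem prj0_inj0 (e : Set Pm) : prj0 (inj0 e) = e := by ext; simp [prj0, inj0]
theorem prj1_inj1 (e : Set Pm) : prj1 (inj1 e) = e := by ext; simp [prj1, inj1]

/-- Case distinction with functions as branches. -/
def caseF (g h : Set Pm → Set Pm) (x : Set Pm) : Set Pm :=
  {p | (Pm.stag false ∈ x ∧ p ∈ g (prj0 x)) ∨ (Pm.stag true ∈ x ∧ p ∈ h (prj1 x))}

theorem caseF_empty (g h : Set Pm → Set Pm) : caseF g h ∅ = ∅ := by ext; simp [caseF]

theorem caseF_inj0 (g h : Set Pm → Set Pm) (e : Set Pm) : caseF g h (inj0 e) = g e := by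
  ext p
  have h0 : Pm.stag false ∈ inj0 e := .inl rfl
  have h1 : Pm.stag true ∉ inj0 e := by simp [inj0]
  simp [caseF, prj0_inj0, h0, h1]

theorem caseF_inj1 (g h : Set Pm → Set Pm) (e : Set Pm) : caseF g h (inj1 e) = h e := by
  ext p
  have h0 : Pm.stag true ∈ inj1 e := .inl rfl
  have h1 : Pm.stag false ∉ inj1 e := by simp [inj1]
  simp [caseF, prj1_inj1, h0, h1]

theorem Fun.case {a b ρ : TyExpr} {g h : Set Pm → Set Pm} (hg : Fun a ρ g) (hh : Fun b ρ h) :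
    Fun (.sum a b) ρ (caseF g h) := by
  obtain ⟨r, ⟨M, m1, m2, m3⟩, hr⟩ := hg.toDef
  obtain ⟨s, ⟨N, n1, n2, n3⟩, hs⟩ := hh.toDef
  obtain ⟨-, -, -, ge⟩ := hg
  obtain ⟨-, -, -, he⟩ := hh
  refine ⟨.app (.app (.app (.const (.ccase a b ρ)) (.var 0)) M) N,
    fun Γ => .app (.app (.app (.const (.ccase a b ρ)) (.var rfl)) (m1 _)) (n1 _), ?_, ?_⟩
  · intro x hx ε
    rw [sem_case (M := .var 0) hx (by rw [m2]; exact m3) (by rw [n2]; exact n3), m2, n2]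
    show caseF (aps r) (aps s) x = _
    rcases El_sum_cases hx with rfl | ⟨e, h, rfl⟩ | ⟨e, h, rfl⟩
    · rw [caseF_empty, caseF_empty]
    · rw [caseF_inj0, caseF_inj0, hr e h]
    · rw [caseF_inj1, caseF_inj1, hs e h]
  · intro x hx
    rcases El_sum_cases hx with rfl | ⟨e, h, rfl⟩ | ⟨e, h, rfl⟩
    · rw [caseF_empty]; exact El_empty _
    · rw [caseF_inj0]; exact ge e h
    · rw [caseF_inj1]; exact he e h

theorem Definable.inj0 {a b : TyExpr} {d : Set Pm} (h : Definable a d) :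
    Definable (.sum a b) (inj0 d) := by
  obtain ⟨M, h1, h2, h3⟩ := h
  refine ⟨.app (.const (.czero a b)) M, fun Γ => .app (.const (.czero a b)) (h1 _), fun ε => ?_,
    El_inj0 h3⟩
  rw [sem_zero (by rw [h2]; exact h3), h2]

theorem Definable.inj1 {a b : TyExpr} {d : Set Pm} (h : Definable b d) :
    Definable (.sum a b) (inj1 d) := by
  obtain ⟨M, h1, h2, h3⟩ := h
  refine ⟨.app (.const (.cone a b)) M, fun Γ => .app (.const (.cone a b)) (h1 _), fun ε => ?_,
    El_inj1 h3⟩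
  rw [sem_one (by rw [h2]; exact h3), h2]

theorem def_tt : Definable tyB {Pm.stag false} := by
  have h := (def_empty .void).inj0 (b := .void)
  have e : RecLam.inj0 ∅ = {Pm.stag false} := by ext; simp [RecLam.inj0]
  rwa [e] at h

theorem def_ff : Definable tyB {Pm.stag true} := by
  have h := (def_empty .void).inj1 (a := .void)
  have e : RecLam.inj1 ∅ = {Pm.stag true} := by ext; simp [RecLam.inj1]
  rwa [e] at h

theorem El_tyB_cases {x : Set Pm} (h : El tyB x) :
    x = ∅ ∨ x = {Pm.stag false} ∨ x = {Pm.stag true} := by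
  have hv : ∀ e, El .void e → e = ∅ := by
    intro e he
    have := he.1
    rw [tyInterp_void] at this
    exact Set.subset_empty_iff.1 this
  rcases El_sum_cases h with rfl | ⟨e, h', rfl⟩ | ⟨e, h', rfl⟩
  · exact .inl rfl
  · rw [hv e h']; right; left; ext; simp [inj0]
  · rw [hv e h']; right; right; ext; simp [inj1]

theorem pcaseS_empty (b c : Set Pm) : pcaseS ∅ b c = b ∩ c := by ext; simp [pcaseS]
theorem pcaseS_tt (b c : Set Pm) : pcaseS {Pm.stag false} b c = b := by ext; simp [pcaseS]
theorem pcaseS_ff (b c : Set Pm) : pcaseS {Pm.stag true} b c = c := by ext; simp [pcaseS]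

theorem El_inter {σ : TyExpr} {b c : Set Pm} (hb : El σ b) (hc : El σ c) : El σ (b ∩ c) :=
  ⟨fun _ h => hb.1 h.1, fun _ _ k h => ⟨hb.2.1 _ _ k h.1, hc.2.1 _ _ k h.2⟩,
    fun _ h _ h' => hb.2.2 _ h.1 _ h'.1⟩

theorem Fun.pcase {σ ρ : TyExpr} {z g h : Set Pm → Set Pm} (hz : Fun σ tyB z) (hg : Fun σ ρ g)
    (hh : Fun σ ρ h) : Fun σ ρ fun x => pcaseS (z x) (g x) (h x) := by
  obtain ⟨B, b1, b2, b3⟩ := hz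
  obtain ⟨M, m1, m2, m3⟩ := hg
  obtain ⟨N, n1, n2, n3⟩ := hh
  refine ⟨.app (.app (.app (.const (.cpcase .void .void ρ)) B) M) N,
    fun Γ => .app (.app (.app (.const (.cpcase .void .void ρ)) (b1 _)) (m1 _)) (n1 _), ?_, ?_⟩
  · intro x hx ε
    rw [sem_pcase (by rw [b2 x hx]; exact b3 x hx) (by rw [m2 x hx]; exact m3 x hx)
      (by rw [n2 x hx]; exact n3 x hx), b2 x hx, m2 x hx, n2 x hx]
  · intro x hx
    rcases El_tyB_cases (b3 x hx) with e | e | e <;> simp only [e]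
    · rw [pcaseS_empty]; exact El_inter (m3 x hx) (n3 x hx)
    · rw [pcaseS_tt]; exact m3 x hx
    · rw [pcaseS_ff]; exact n3 x hx

/-! ### Products -/

theorem El_fst {a b : TyExpr} {x : Set Pm} (h : El (.prod a b) x) : El a (fstS x) := by
  rw [El, tyInterp_prod] at h
  obtain ⟨h1, h2, h3⟩ := h
  refine ⟨?_, ?_, ?_⟩
  · intro u hu
    rcases h1 hu with ⟨c, hc, k⟩ | ⟨c, hc, k⟩ <;> cases k
    exact hc
  · intro u v huv hv
    exact h2 _ _ (.inl ⟨u, v, rfl, rfl, huv⟩) hv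
  · intro u hu v hv
    rcases h3 _ hu _ hv with ⟨c, c', k, k', m⟩ | ⟨c, c', k, k', m⟩ | ⟨c, c', k, k', m⟩ |
      ⟨c, c', k, k', m⟩ <;> cases k <;> cases k'
    exact m

theorem El_snd {a b : TyExpr} {x : Set Pm} (h : El (.prod a b) x) : El b (sndS x) := by
  rw [El, tyInterp_prod] at h
  obtain ⟨h1, h2, h3⟩ := h
  refine ⟨?_, ?_, ?_⟩
  · intro u hu
    rcases h1 hu with ⟨c, hc, k⟩ | ⟨c, hc, k⟩ <;> cases k
    exact hc
  · intro u v huv hv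
    exact h2 _ _ (.inr ⟨u, v, rfl, rfl, huv⟩) hv
  · intro u hu v hv
    rcases h3 _ hu _ hv with ⟨c, c', k, k', m⟩ | ⟨c, c', k, k', m⟩ | ⟨c, c', k, k', m⟩ |
      ⟨c, c', k, k', m⟩ <;> cases k <;> cases k'
    exact m

theorem Fun.fst (a b : TyExpr) : Fun (.prod a b) a fstS :=
  ⟨.app (.const (.cfst a b)) (.var 0), fun Γ => .app (.const (.cfst a b)) (.var rfl),
    fun _ hx _ => sem_fst (M := .var 0) hx, fun _ hx => El_fst hx⟩

theorem Fun.snd (a b : TyExpr) : Fun (.prod a b) b sndS :=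
  ⟨.app (.const (.csnd a b)) (.var 0), fun Γ => .app (.const (.csnd a b)) (.var rfl),
    fun _ hx _ => sem_snd (M := .var 0) hx, fun _ hx => El_snd hx⟩

theorem El_pair {a b : TyExpr} {d e : Set Pm} (hd : El a d) (he : El b e) :
    El (.prod a b) (pairS d e) := by
  rw [El, tyInterp_prod]
  refine ⟨?_, ?_, ?_⟩
  · rintro _ (⟨c, hc, rfl⟩ | ⟨c, hc, rfl⟩)
    · exact .inl ⟨c, hd.1 hc, rfl⟩
    · exact .inr ⟨c, he.1 hc, rfl⟩
  · rintro _ _ (⟨u, v, rfl, rfl, k⟩ | ⟨u, v, rfl, rfl, k⟩) (⟨c, hc, m⟩ | ⟨c, hc, m⟩) <;> cases m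
    · exact .inl ⟨u, hd.2.1 _ _ k hc, rfl⟩
    · exact .inr ⟨u, he.2.1 _ _ k hc, rfl⟩
  · rintro _ (⟨c, hc, rfl⟩ | ⟨c, hc, rfl⟩) _ (⟨c', hc', rfl⟩ | ⟨c', hc', rfl⟩)
    · exact .inl ⟨c, c', rfl, rfl, hd.2.2 _ hc _ hc'⟩
    · exact .inr (.inr (.inl ⟨c, c', rfl, rfl, hd.1 hc, he.1 hc'⟩))
    · exact .inr (.inr (.inr ⟨c, c', rfl, rfl, he.1 hc, hd.1 hc'⟩))
    · exact .inr (.inl ⟨c, c', rfl, rfl, he.2.2 _ hc _ hc'⟩)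

theorem Definable.pair {a b : TyExpr} {d e : Set Pm} (hd : Definable a d) (he : Definable b e) :
    Definable (.prod a b) (pairS d e) := by
  obtain ⟨M, m1, m2, m3⟩ := hd
  obtain ⟨N, n1, n2, n3⟩ := he
  refine ⟨.app (.app (.const (.cpair a b)) M) N,
    fun Γ => .app (.app (.const (.cpair a b)) (m1 _)) (n1 _), fun ε => ?_, El_pair m3 n3⟩
  rw [sem_pair (by rw [m2]; exact m3) (by rw [n2]; exact n3), m2, n2]

/-! ### The main induction -/

/-- The test for the prime `a`. -/
def test (a : Pm) (x : Set Pm) : Set Pm := {p | p = Pm.stag false ∧ a ∈ x}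

theorem test_pos {a : Pm} {x : Set Pm} (h : a ∈ x) : test a x = {Pm.stag false} := by
  ext; simp [test, h]

theorem test_neg {a : Pm} {x : Set Pm} (h : a ∉ x) : test a x = ∅ := by
  ext; simp [test, h]

/-- `f` separates the primes `a` and `b`. -/
def Sep (σ : TyExpr) (a b : Pm) (f : Set Pm → Set Pm) : Prop :=
  ∀ x, El σ x → (a ∈ x → f x = {Pm.stag false}) ∧ (b ∈ x → f x = {Pm.stag true})

/-- The induction hypothesis. -/
structure Good (σ : TyExpr) (P : PData) : Prop where
  sub : Sub P (tyInterp σ)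
  M : ∀ X : List Pm, (∀ x ∈ X, x ∈ P.carrier) → (∀ x ∈ X, ∀ y ∈ X, (tyInterp σ).con x y) →
    Definable σ (downListP (tyInterp σ) X)
  T : ∀ a ∈ P.carrier, Fun σ tyB (test a)
  S : ∀ a ∈ P.carrier, ∀ b ∈ P.carrier, ¬ (tyInterp σ).con a b → ∃ f, Fun σ tyB f ∧ Sep σ a b f

theorem downList_nil (A : PData) : downListP A [] = ∅ := by ext; simp [downListP]

theorem good_void (σ : TyExpr) : Good σ voidP := by
  refine ⟨sub_void _, ?_, ?_, ?_⟩
  · intro X hX _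
    cases X with
    | nil => rw [downList_nil]; exact def_empty σ
    | cons x X => exact absurd (hX x List.mem_cons_self) (by simp [voidP])
  · intro a ha; exact absurd ha (by simp [voidP])
  · intro a ha; exact absurd ha (by simp [voidP])

theorem good_transfer {σ τ : TyExpr} {P : PData} (h : Unfolds σ τ) (g : Good τ P) : Good σ P := by
  have e := unfolding_eq h
  have et : tyInterp σ = tyInterp τ := by simp only [tyInterp, e]
  have hE : ∀ x, El σ x ↔ El τ x := by intro x; rw [El, El, et]
  have hD : ∀ d, Definable τ d → Definable σ d := by
    rintro d ⟨M, h1, h2, h3⟩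
    exact ⟨M, fun Γ => .equiv (h1 Γ) e.symm, h2, (hE _).2 h3⟩
  have hF : ∀ f, Fun τ tyB f → Fun σ tyB f := by
    intro f hf
    obtain ⟨r, ⟨M, h1, h2, h3⟩, hr⟩ := hf.toDef
    have e' : unfolding (.arrow σ tyB) = unfolding (.arrow τ tyB) :=
      unfolding_eq (Unfolds.arrow h .refl)
    have : Definable (.arrow σ tyB) r :=
      ⟨M, fun Γ => .equiv (h1 Γ) e'.symm, h2, by
        rw [El, tyInterp_arrow] at h3 ⊢
        rwa [et]⟩
    exact this.fun.congr fun x hx => (hr x ((hE x).1 hx)).symm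
  refine ⟨et ▸ g.sub, ?_, ?_, ?_⟩
  · intro X h1 h2
    rw [et] at h2 ⊢
    exact hD _ (g.M X h1 h2)
  · intro a ha; exact hF _ (g.T a ha)
  · intro a ha b hb hab
    rw [et] at hab
    obtain ⟨f, hf, hs⟩ := g.S a ha b hb hab
    exact ⟨f, hF f hf, fun x hx => hs x ((hE x).1 hx)⟩

/-! Sums -/

/-- Extract the components on side `s` of a sum. -/
def unspr (s : Bool) : Pm → Option Pm
  | .spr t a => if t = s then some a else none
  | _ => none

theorem mem_unspr {s : Bool} {X : List Pm} {a : Pm} :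
    a ∈ X.filterMap (unspr s) ↔ Pm.spr s a ∈ X := by
  rw [List.mem_filterMap]
  constructor
  · rintro ⟨p, hp, e⟩
    cases p with
    | spr t c =>
      simp only [unspr] at e
      split_ifs at e with h
      subst h
      cases e
      exact hp
    | _ => simp [unspr] at e
  · intro h
    exact ⟨_, h, by simp [unspr]⟩

theorem good_sum {a b : TyExpr} {P Q : PData} (ga : Good a P) (gb : Good b Q) :
    Good (.sum a b) (sumP P Q) := by
  have la := laws_ty a
  have lb := laws_ty b
  refine ⟨by rw [tyInterp_sum]; exact sub_sum ga.sub gb.sub, ?_, ?_, ?_⟩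
  · intro X hX hc
    rw [tyInterp_sum] at hc ⊢
    cases X with
    | nil => rw [downList_nil]; exact def_empty _
    | cons z Z =>
      have hcar : ∀ x ∈ z :: Z, x ∈ (sumP (tyInterp a) (tyInterp b)).carrier := fun x hx =>
        (sub_sum ga.sub gb.sub).car x (hX x hx)
      generalize hW : z :: Z = W at *
      have hz : z ∈ W := by rw [← hW]; exact List.mem_cons_self
      by_cases hs : z ∈ sumSideP (tyInterp a) false
      · have hside : ∀ x ∈ W, x ∈ sumSideP (tyInterp a) false := by
          intro x hx
          rcases hc z hz x hx with ⟨-, k, -⟩ | ⟨k, -⟩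
          · exact k
          · exfalso
            rcases hs with rfl | ⟨c, _, rfl⟩ <;> rcases k with k | ⟨_, _, k⟩ <;> cases k
        have := (ga.M (W.filterMap (unspr false)) ?_ ?_).inj0 (b := b)
        · convert this using 1
          ext p
          constructor
          · rintro ⟨x, hx, (⟨rfl, -⟩ | ⟨rfl, k⟩ | ⟨u, v, rfl, rfl, k⟩ | ⟨u, v, rfl, rfl, k⟩)⟩
            · exact .inl rfl
            · rcases hside x hx with rfl | ⟨c, _, rfl⟩ <;> rcases k with k | ⟨_, _, k⟩ <;> cases k
            · exact .inr ⟨u, ⟨v, mem_unspr.2 hx, k⟩, rfl⟩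
            · rcases hside _ hx with k | ⟨c, _, k⟩ <;> cases k
          · rintro (rfl | ⟨u, ⟨v, hv, k⟩, rfl⟩)
            · exact ⟨z, hz, .inl ⟨rfl, hs⟩⟩
            · exact ⟨_, mem_unspr.1 hv, .inr (.inr (.inl ⟨u, v, rfl, rfl, k⟩))⟩
        · intro x hx
          rcases hX _ (mem_unspr.1 hx) with (k | ⟨c, hc, k⟩) | (k | ⟨c, hc, k⟩) <;> cases k
          exact hc
        · intro x hx y hy
          rcases hc _ (mem_unspr.1 hx) _ (mem_unspr.1 hy) with ⟨-, -, k⟩ | ⟨k, -⟩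
          · exact k _ _ rfl rfl
          · rcases k with k | ⟨_, _, k⟩ <;> cases k
      · have hs : z ∈ sumSideP (tyInterp b) true := (hcar z hz).resolve_left hs
        have hside : ∀ x ∈ W, x ∈ sumSideP (tyInterp b) true := by
          intro x hx
          rcases hc z hz x hx with ⟨k, -⟩ | ⟨-, k, -⟩
          · exfalso
            rcases hs with rfl | ⟨c, _, rfl⟩ <;> rcases k with k | ⟨_, _, k⟩ <;> cases k
          · exact k
        have := (gb.M (W.filterMap (unspr true)) ?_ ?_).inj1 (a := a)
        · convert this using 1
          ext p
          constructor
          · rintro ⟨x, hx, (⟨rfl, k⟩ | ⟨rfl, -⟩ | ⟨u, v, rfl, rfl, k⟩ | ⟨u, v, rfl, rfl, k⟩)⟩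
            · rcases hside x hx with rfl | ⟨c, _, rfl⟩ <;> rcases k with k | ⟨_, _, k⟩ <;> cases k
            · exact .inl rfl
            · rcases hside _ hx with k | ⟨c, _, k⟩ <;> cases k
            · exact .inr ⟨u, ⟨v, mem_unspr.2 hx, k⟩, rfl⟩
          · rintro (rfl | ⟨u, ⟨v, hv, k⟩, rfl⟩)
            · exact ⟨z, hz, .inr (.inl ⟨rfl, hs⟩)⟩
            · exact ⟨_, mem_unspr.1 hv, .inr (.inr (.inr ⟨u, v, rfl, rfl, k⟩))⟩
        · intro x hx
          rcases hX _ (mem_unspr.1 hx) with (k | ⟨c, hc, k⟩) | (k | ⟨c, hc, k⟩) <;> cases k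
          exact hc
        · intro x hx y hy
          rcases hc _ (mem_unspr.1 hx) _ (mem_unspr.1 hy) with ⟨k, -⟩ | ⟨-, -, k⟩
          · rcases k with k | ⟨_, _, k⟩ <;> cases k
          · exact k _ _ rfl rfl
  · rintro _ ((rfl | ⟨c, hc, rfl⟩) | (rfl | ⟨c, hc, rfl⟩))
    · refine (Fun.case (def_tt.const (σ := a)) ((def_empty tyB).const (σ := b))).congr ?_
      intro x hx
      rcases El_sum_cases hx with rfl | ⟨e, h, rfl⟩ | ⟨e, h, rfl⟩
      · rw [caseF_empty, test_neg (by simp)]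
      · rw [caseF_inj0, test_pos (.inl rfl)]
      · rw [caseF_inj1, test_neg (by simp [inj1])]
    · refine (Fun.case (ga.T c hc) ((def_empty tyB).const (σ := b))).congr ?_
      intro x hx
      rcases El_sum_cases hx with rfl | ⟨e, h, rfl⟩ | ⟨e, h, rfl⟩
      · rw [caseF_empty, test_neg (by simp)]
      · rw [caseF_inj0]; ext; simp [test, inj0]
      · rw [caseF_inj1, test_neg (by simp [inj1])]
    · refine (Fun.case ((def_empty tyB).const (σ := a)) (def_tt.const (σ := b))).congr ?_
      intro x hx
      rcases El_sum_cases hx with rfl | ⟨e, h, rfl⟩ | ⟨e, h, rfl⟩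
      · rw [caseF_empty, test_neg (by simp)]
      · rw [caseF_inj0, test_neg (by simp [inj0])]
      · rw [caseF_inj1, test_pos (.inl rfl)]
    · refine (Fun.case ((def_empty tyB).const (σ := a)) (gb.T c hc)).congr ?_
      intro x hx
      rcases El_sum_cases hx with rfl | ⟨e, h, rfl⟩ | ⟨e, h, rfl⟩
      · rw [caseF_empty, test_neg (by simp)]
      · rw [caseF_inj0, test_neg (by simp [inj0])]
      · rw [caseF_inj1]; ext; simp [test, inj1]
  · have sideP : ∀ x, x ∈ sumSideP P false → x ∈ sumSideP (tyInterp a) false := by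
      rintro _ (rfl | ⟨c, hc, rfl⟩)
      · exact .inl rfl
      · exact .inr ⟨c, ga.sub.car _ hc, rfl⟩
    have sideQ : ∀ x, x ∈ sumSideP Q true → x ∈ sumSideP (tyInterp b) true := by
      rintro _ (rfl | ⟨c, hc, rfl⟩)
      · exact .inl rfl
      · exact .inr ⟨c, gb.sub.car _ hc, rfl⟩
    have mem0 : ∀ x, x ∈ sumSideP P false → ∀ e, x ∉ inj1 e := by
      rintro _ (rfl | ⟨c, hc, rfl⟩) e <;> simp [inj1]
    have mem1 : ∀ x, x ∈ sumSideP Q true → ∀ e, x ∉ inj0 e := by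
      rintro _ (rfl | ⟨c, hc, rfl⟩) e <;> simp [inj0]
    rintro x hx y hy hxy
    rw [tyInterp_sum] at hxy
    rcases hx with hx | hx <;> rcases hy with hy | hy
    · have : ∃ u v, x = .spr false u ∧ y = .spr false v ∧ ¬ (tyInterp a).con u v := by
        by_contra hne
        push Not at hne
        exact hxy (.inl ⟨sideP x hx, sideP y hy, fun u v h1 h2 => hne u v h1 h2⟩)
      obtain ⟨u, v, rfl, rfl, huv⟩ := this
      rcases hx with k | ⟨u', hu, k⟩ <;> cases k
      rcases hy with k | ⟨v', hv, k⟩ <;> cases k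
      obtain ⟨f, hf, hs⟩ := ga.S u hu v hv huv
      refine ⟨_, Fun.case hf ((def_empty tyB).const (σ := b)), ?_⟩
      intro x hx
      rcases El_sum_cases hx with rfl | ⟨e, h, rfl⟩ | ⟨e, h, rfl⟩
      · simp
      · rw [caseF_inj0]
        simpa [inj0] using hs e h
      · simp [inj1]
    · refine ⟨_, Fun.case (def_tt.const (σ := a)) (def_ff.const (σ := b)), ?_⟩
      intro z hz
      rcases El_sum_cases hz with rfl | ⟨e, h, rfl⟩ | ⟨e, h, rfl⟩
      · simp
      · rw [caseF_inj0]
        exact ⟨fun _ => rfl, fun h => absurd h (mem1 y hy e)⟩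
      · rw [caseF_inj1]
        exact ⟨fun h => absurd h (mem0 x hx e), fun _ => rfl⟩
    · refine ⟨_, Fun.case (def_ff.const (σ := a)) (def_tt.const (σ := b)), ?_⟩
      intro z hz
      rcases El_sum_cases hz with rfl | ⟨e, h, rfl⟩ | ⟨e, h, rfl⟩
      · simp
      · rw [caseF_inj0]
        exact ⟨fun h => absurd h (mem1 x hx e), fun _ => rfl⟩
      · rw [caseF_inj1]
        exact ⟨fun _ => rfl, fun h => absurd h (mem0 y hy e)⟩
    · have : ∃ u v, x = .spr true u ∧ y = .spr true v ∧ ¬ (tyInterp b).con u v := by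
        by_contra hne
        push Not at hne
        exact hxy (.inr ⟨sideQ x hx, sideQ y hy, fun u v h1 h2 => hne u v h1 h2⟩)
      obtain ⟨u, v, rfl, rfl, huv⟩ := this
      rcases hx with k | ⟨u', hu, k⟩ <;> cases k
      rcases hy with k | ⟨v', hv, k⟩ <;> cases k
      obtain ⟨f, hf, hs⟩ := gb.S u hu v hv huv
      refine ⟨_, Fun.case ((def_empty tyB).const (σ := a)) hf, ?_⟩
      intro x hx
      rcases El_sum_cases hx with rfl | ⟨e, h, rfl⟩ | ⟨e, h, rfl⟩
      · simp
      · simp [inj0]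
      · rw [caseF_inj1]
        simpa [inj1] using hs e h

/-! Products -/

/-- Extract the components on side `s` of a product. -/
def unppr (s : Bool) : Pm → Option Pm
  | .ppr t a => if t = s then some a else none
  | _ => none

theorem mem_unppr {s : Bool} {X : List Pm} {a : Pm} :
    a ∈ X.filterMap (unppr s) ↔ Pm.ppr s a ∈ X := by
  rw [List.mem_filterMap]
  constructor
  · rintro ⟨p, hp, e⟩
    cases p with
    | ppr t c =>
      simp only [unppr] at e
      split_ifs at e with h
      subst h
      cases e
      exact hp
    | _ => simp [unppr] at e
  · intro h
    exact ⟨_, h, by simp [unppr]⟩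

theorem good_prod {a b : TyExpr} {P Q : PData} (ga : Good a P) (gb : Good b Q) :
    Good (.prod a b) (prodP P Q) := by
  refine ⟨by rw [tyInterp_prod]; exact sub_prod ga.sub gb.sub, ?_, ?_, ?_⟩
  · intro X hX hc
    rw [tyInterp_prod] at hc ⊢
    have := (ga.M (X.filterMap (unppr false)) ?_ ?_).pair (gb.M (X.filterMap (unppr true)) ?_ ?_)
    · convert this using 1
      ext p
      constructor
      · rintro ⟨x, hx, (⟨u, v, rfl, rfl, k⟩ | ⟨u, v, rfl, rfl, k⟩)⟩
        · exact .inl ⟨u, ⟨v, mem_unppr.2 hx, k⟩, rfl⟩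
        · exact .inr ⟨u, ⟨v, mem_unppr.2 hx, k⟩, rfl⟩
      · rintro (⟨u, ⟨v, hv, k⟩, rfl⟩ | ⟨u, ⟨v, hv, k⟩, rfl⟩)
        · exact ⟨_, mem_unppr.1 hv, .inl ⟨u, v, rfl, rfl, k⟩⟩
        · exact ⟨_, mem_unppr.1 hv, .inr ⟨u, v, rfl, rfl, k⟩⟩
    · intro x hx
      rcases hX _ (mem_unppr.1 hx) with ⟨c, hc, k⟩ | ⟨c, hc, k⟩ <;> cases k
      exact hc
    · intro x hx y hy
      rcases hc _ (mem_unppr.1 hx) _ (mem_unppr.1 hy) with ⟨u, v, k, k', m⟩ | ⟨u, v, k, k', m⟩ |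
        ⟨u, v, k, k', m⟩ | ⟨u, v, k, k', m⟩ <;> cases k <;> cases k'
      exact m
    · intro x hx
      rcases hX _ (mem_unppr.1 hx) with ⟨c, hc, k⟩ | ⟨c, hc, k⟩ <;> cases k
      exact hc
    · intro x hx y hy
      rcases hc _ (mem_unppr.1 hx) _ (mem_unppr.1 hy) with ⟨u, v, k, k', m⟩ | ⟨u, v, k, k', m⟩ |
        ⟨u, v, k, k', m⟩ | ⟨u, v, k, k', m⟩ <;> cases k <;> cases k'
      exact m
  · rintro _ (⟨c, hc, rfl⟩ | ⟨c, hc, rfl⟩)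
    · exact ((ga.T c hc).comp (Fun.fst a b)).congr fun x hx => rfl
    · exact ((gb.T c hc).comp (Fun.snd a b)).congr fun x hx => rfl
  · intro x hx y hy hxy
    rw [tyInterp_prod] at hxy
    rcases hx with ⟨u, hu, rfl⟩ | ⟨u, hu, rfl⟩ <;> rcases hy with ⟨v, hv, rfl⟩ | ⟨v, hv, rfl⟩
    · obtain ⟨f, hf, hs⟩ := ga.S u hu v hv fun k => hxy (.inl ⟨u, v, rfl, rfl, k⟩)
      exact ⟨_, hf.comp (Fun.fst a b), fun z hz => hs _ (El_fst hz)⟩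
    · exact absurd (.inr (.inr (.inl ⟨u, v, rfl, rfl, ga.sub.car _ hu, gb.sub.car _ hv⟩))) hxy
    · exact absurd (.inr (.inr (.inr ⟨u, v, rfl, rfl, gb.sub.car _ hu, ga.sub.car _ hv⟩))) hxy
    · obtain ⟨f, hf, hs⟩ := gb.S u hu v hv fun k => hxy (.inr (.inl ⟨u, v, rfl, rfl, k⟩))
      exact ⟨_, hf.comp (Fun.snd a b), fun z hz => hs _ (El_snd hz)⟩

/-! Function spaces -/

/-- The test for a list of primes. -/
def testL (X : List Pm) (x : Set Pm) : Set Pm := {p | p = Pm.stag false ∧ ∀ u ∈ X, u ∈ x}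

theorem fun_testL {a : TyExpr} {P : PData} (ga : Good a P) (X : List Pm)
    (hX : ∀ x ∈ X, x ∈ P.carrier) : Fun a tyB (testL X) := by
  induction X with
  | nil =>
    refine (def_tt.const (σ := a)).congr fun x hx => ?_
    ext; simp [testL]
  | cons c X ih =>
    refine (Fun.pcase (ga.T c (hX c List.mem_cons_self))
      (ih fun x hx => hX x (List.mem_cons_of_mem _ hx)) ((def_empty tyB).const (σ := a))).congr ?_
    intro x hx
    by_cases h : c ∈ x
    · rw [test_pos h, pcaseS_tt]; ext; simp [testL, h]
    · rw [test_neg h, pcaseS_empty]; ext; simp [testL, h]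

/-- The action of a finite list of function primes. -/
def act (B : PData) (L : List (List Pm × Pm)) (x : Set Pm) : Set Pm :=
  {b | ∃ p ∈ L, (∀ u ∈ p.1, u ∈ x) ∧ B.le b p.2}

theorem fun_acc {a b : TyExpr} {P Q : PData} (ga : Good a P) (gb : Good b Q)
    (L : List (List Pm × Pm)) : ∀ Acc : List Pm,
    (∀ p ∈ L, (∀ u ∈ p.1, u ∈ P.carrier) ∧ p.2 ∈ Q.carrier) → (∀ c ∈ Acc, c ∈ Q.carrier) →
    (∀ c ∈ L.map Prod.snd ++ Acc, ∀ d ∈ L.map Prod.snd ++ Acc, (tyInterp b).con c d) →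
    Fun a b fun x => downListP (tyInterp b) Acc ∪ act (tyInterp b) L x := by
  induction L with
  | nil =>
    intro Acc _ h2 h3
    refine ((gb.M Acc h2 (by simpa using h3)).const (σ := a)).congr fun x hx => ?_
    ext; simp [act]
  | cons p L ih =>
    intro Acc h1 h2 h3
    have f1 := ih (p.2 :: Acc) (fun q hq => h1 q (List.mem_cons_of_mem _ hq))
      (by
        intro c hc
        rcases List.mem_cons.1 hc with rfl | hc
        · exact (h1 p List.mem_cons_self).2
        · exact h2 c hc)
      (by
        intro c hc d hd
        refine h3 c ?_ d ?_
        · simp only [List.mem_append, List.mem_cons, List.map_cons] at hc ⊢; tauto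
        · simp only [List.mem_append, List.mem_cons, List.map_cons] at hd ⊢; tauto)
    have f2 := ih Acc (fun q hq => h1 q (List.mem_cons_of_mem _ hq)) h2
      (by
        intro c hc d hd
        refine h3 c ?_ d ?_
        · simp only [List.mem_append, List.mem_cons, List.map_cons] at hc ⊢; tauto
        · simp only [List.mem_append, List.mem_cons, List.map_cons] at hd ⊢; tauto)
    refine (Fun.pcase (fun_testL ga p.1 (h1 p List.mem_cons_self).1) f1 f2).congr fun x hx => ?_
    by_cases h : ∀ u ∈ p.1, u ∈ x
    · have e : testL p.1 x = {Pm.stag false} := by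
        ext q
        exact ⟨fun k => k.1, fun k => ⟨k, h⟩⟩
      rw [e, pcaseS_tt]
      ext q
      simp only [downListP, act, Set.mem_union, Set.mem_ofPred_eq, List.mem_cons, exists_eq_or_imp,
        eq_true h, true_and, or_assoc]
      exact or_left_comm
    · have e : testL p.1 x = ∅ := by
        ext q
        simp only [testL, Set.mem_ofPred_eq, Set.mem_empty_iff_false, iff_false]
        tauto
      rw [e, pcaseS_empty]
      ext q
      simp only [downListP, act, Set.mem_union, Set.mem_inter_iff, Set.mem_ofPred_eq,
        List.mem_cons, exists_eq_or_imp, eq_false h, false_and, false_or]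
      constructor
      · rintro (k | k)
        · exact ⟨.inl (.inr k), .inl k⟩
        · exact ⟨.inr k, .inr k⟩
      · exact fun k => k.2

theorem act_filter [DecidableEq (List Pm × Pm)] {B : PData} {L : List (List Pm × Pm)}
    {q : List Pm × Pm} {x : Set Pm}
    (h : ¬ ∀ u ∈ q.1, u ∈ x) : act B (L.filter (· ≠ q)) x = act B L x := by
  ext c
  constructor
  · rintro ⟨p, hp, k⟩
    exact ⟨p, List.mem_of_mem_filter hp, k⟩
  · rintro ⟨p, hp, k⟩
    refine ⟨p, List.mem_filter.2 ⟨hp, ?_⟩, k⟩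
    simp only [ne_eq, decide_not, Bool.not_eq_eq_eq_not, Bool.not_true, decide_eq_false_iff_not]
    rintro rfl
    exact h k.1

theorem fun_act {a b : TyExpr} {P Q : PData} (ga : Good a P) (gb : Good b Q) (n : ℕ) :
    ∀ L : List (List Pm × Pm), L.length ≤ n →
    (∀ p ∈ L, (∀ u ∈ p.1, u ∈ P.carrier) ∧ p.2 ∈ Q.carrier) →
    (∀ p ∈ L, ∀ q ∈ L, ¬ (tyInterp b).con p.2 q.2 →
      ∃ u ∈ p.1, ∃ v ∈ q.1, ¬ (tyInterp a).con u v) →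
    Fun a b (act (tyInterp b) L) := by
  classical
  induction n with
  | zero =>
    intro L hL _ _
    have : L = [] := List.length_eq_zero_iff.1 (by omega)
    subst this
    refine ((def_empty b).const (σ := a)).congr fun x hx => ?_
    ext; simp [act]
  | succ n ih =>
    intro L hL h1 h2
    by_cases hc : ∀ p ∈ L, ∀ q ∈ L, (tyInterp b).con p.2 q.2
    · refine (fun_acc ga gb L [] h1 (by simp) ?_).congr fun x hx => ?_
      · intro c hc1 d hd1
        simp only [List.append_nil, List.mem_map] at hc1 hd1
        obtain ⟨p, hp, rfl⟩ := hc1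
        obtain ⟨q, hq, rfl⟩ := hd1
        exact hc p hp q hq
      · rw [downList_nil, Set.empty_union]
    · push Not at hc
      obtain ⟨p, hp, q, hq, hpq⟩ := hc
      obtain ⟨u, hu, v, hv, huv⟩ := h2 p hp q hq hpq
      obtain ⟨f, hf, hs⟩ := ga.S u ((h1 p hp).1 u hu) v ((h1 q hq).1 v hv) huv
      have hlen : ∀ r ∈ L, (L.filter (· ≠ r)).length ≤ n := by
        intro r hr
        have : (L.filter (· ≠ r)).length < L.length :=
          List.length_filter_lt_length_iff_exists.2 ⟨r, hr, by simp⟩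
        omega
      have hrec : ∀ r ∈ L, Fun a b (act (tyInterp b) (L.filter (· ≠ r))) := fun r hr =>
        ih _ (hlen r hr) (fun s hs => h1 s (List.mem_of_mem_filter hs))
          fun s hs t ht => h2 s (List.mem_of_mem_filter hs) t (List.mem_of_mem_filter ht)
      refine (Fun.pcase hf (hrec q hq) (hrec p hp)).congr fun x hx => ?_
      obtain ⟨s1, s2⟩ := hs x hx
      obtain ⟨-, -, -, hfe⟩ := hf
      have np : u ∉ x → ¬ ∀ w ∈ p.1, w ∈ x := fun h k => h (k u hu)
      have nq : v ∉ x → ¬ ∀ w ∈ q.1, w ∈ x := fun h k => h (k v hv)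
      have ne1 : (∅ : Set Pm) ≠ {Pm.stag false} := (Set.singleton_ne_empty _).symm
      have ne2 : (∅ : Set Pm) ≠ {Pm.stag true} := (Set.singleton_ne_empty _).symm
      have ne3 : ({Pm.stag false} : Set Pm) ≠ {Pm.stag true} := by simp
      rcases El_tyB_cases (hfe x hx) with e | e | e <;> rw [e] at s1 s2 ⊢
      · rw [pcaseS_empty, act_filter (np fun h => ne1 (s1 h)), act_filter (nq fun h => ne2 (s2 h)),
          Set.inter_self]
      · rw [pcaseS_tt, act_filter (nq fun h => ne3 (s2 h))]
      · rw [pcaseS_ff, act_filter (np fun h => ne3 (s1 h).symm)]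

theorem good_arrow {a b : TyExpr} {P Q : PData} (ga : Good a P) (gb : Good b Q) :
    Good (.arrow a b) (funcP P Q) := by
  have la := laws_ty a
  have lb := laws_ty b
  have good : ∀ X, goodList P X → goodList (tyInterp a) X := fun X h => (ga.sub.good h.1).1 h
  have defX : ∀ X, (∀ x ∈ X, x ∈ P.carrier) → (∀ x ∈ X, ∀ y ∈ X, (tyInterp a).con x y) →
      Fun (.arrow a b) b fun r => aps r (downListP (tyInterp a) X) := fun X h1 h2 =>
    (Fun.id (.arrow a b)).app (ga.M X h1 h2).const
  refine ⟨by rw [tyInterp_arrow]; exact sub_func ga.sub gb.sub, ?_, ?_, ?_⟩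
  · intro X hX hc
    have hL : ∃ L : List (List Pm × Pm), X = L.map fun p => Pm.fn p.1 p.2 := by
      clear hc
      induction X with
      | nil => exact ⟨[], rfl⟩
      | cons x X ih =>
        obtain ⟨L, hL⟩ := ih fun y hy => hX y (List.mem_cons_of_mem _ hy)
        obtain ⟨Y, c, rfl, -⟩ := hX x List.mem_cons_self
        exact ⟨(Y, c) :: L, by simp [hL]⟩
    obtain ⟨L, rfl⟩ := hL
    have hm : ∀ p ∈ L, goodList P p.1 ∧ p.2 ∈ Q.carrier := by
      intro p hp
      obtain ⟨Y, c, e, h1, h2⟩ := hX _ (List.mem_map_of_mem hp)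
      cases e
      exact ⟨h1, h2⟩
    rw [tyInterp_arrow] at hc ⊢
    have hinc : ∀ p ∈ L, ∀ q ∈ L, ¬ (tyInterp b).con p.2 q.2 →
        ∃ u ∈ p.1, ∃ v ∈ q.1, ¬ (tyInterp a).con u v := by
      intro p hp q hq hpq
      obtain ⟨Y, c, Z, d, e, e', -, -, -, -, k⟩ :=
        hc _ (List.mem_map_of_mem hp) _ (List.mem_map_of_mem hq)
      cases e
      cases e'
      by_contra hne
      push Not at hne
      exact hpq (k hne)
    obtain ⟨r, hr, hact⟩ := (fun_act ga gb L.length L le_rfl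
      (fun p hp => ⟨(hm p hp).1.1, (hm p hp).2⟩) hinc).toDef
    have hre : (funcP (tyInterp a) (tyInterp b)).IsElem r := by
      obtain ⟨-, -, -, h⟩ := hr
      rwa [El, tyInterp_arrow] at h
    have hd := elem_down (laws_func la lb) hc
    have : downListP (funcP (tyInterp a) (tyInterp b)) (L.map fun p => Pm.fn p.1 p.2) = r := by
      refine elem_ext la lb hd hre fun x hx => ?_
      rw [hact x hx]
      ext c
      constructor
      · rintro ⟨Y, hY, z, hz, k⟩
        obtain ⟨p, hp, rfl⟩ := List.mem_map.1 hz
        obtain ⟨Y', c', Z, d, e, e', -, -, -, -, k1, k2⟩ := k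
        cases e
        cases e'
        refine ⟨p, hp, fun u hu => ?_, k2⟩
        obtain ⟨w, hw, hle⟩ := k1 u hu
        exact hx.2.1 _ _ hle (hY w hw)
      · rintro ⟨p, hp, h1, h2⟩
        refine ⟨p.1, h1, _, List.mem_map_of_mem hp, p.1, c, p.1, p.2, rfl, rfl,
          good _ (hm p hp).1, (lb.le_mem _ _ h2).1, good _ (hm p hp).1, (lb.le_mem _ _ h2).2,
          fun v hv => ⟨v, hv, la.le_refl _ ((good _ (hm p hp).1).1 v hv)⟩, h2⟩
    rw [this]
    exact hr
  · rintro _ ⟨X, c, rfl, hX, hc⟩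
    refine ((gb.T c hc).comp (defX X hX.1 fun x hx y hy => ((good X hX).2 x hx y hy).1)).congr ?_
    intro r hr
    rw [El, tyInterp_arrow] at hr
    ext p
    exact and_congr_right fun _ => fn_mem_iff la lb hr (good X hX) c
  · rintro _ ⟨X, c, rfl, hX, hc⟩ _ ⟨Y, d, rfl, hY, hd⟩ hxy
    rw [tyInterp_arrow] at hxy
    have hXY : ∀ u ∈ X, ∀ v ∈ Y, (tyInterp a).con u v := by
      by_contra hne
      exact hxy ⟨X, c, Y, d, rfl, rfl, good X hX, gb.sub.car _ hc, good Y hY, gb.sub.car _ hd,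
        fun k => absurd k hne⟩
    have hcd : ¬ (tyInterp b).con c d := fun k =>
      hxy ⟨X, c, Y, d, rfl, rfl, good X hX, gb.sub.car _ hc, good Y hY, gb.sub.car _ hd,
        fun _ => k⟩
    obtain ⟨f, hf, hs⟩ := gb.S c hc d hd hcd
    have hall : ∀ x ∈ X ++ Y, ∀ y ∈ X ++ Y, (tyInterp a).con x y := by
      intro x hx y hy
      rcases List.mem_append.1 hx with hx | hx <;> rcases List.mem_append.1 hy with hy | hy
      · exact ((good X hX).2 x hx y hy).1
      · exact hXY x hx y hy
      · exact la.con_symm _ _ (hXY y hy x hx)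
      · exact ((good Y hY).2 x hx y hy).1
    have hmem : ∀ x ∈ X ++ Y, x ∈ P.carrier := by
      intro x hx
      rcases List.mem_append.1 hx with hx | hx
      · exact hX.1 x hx
      · exact hY.1 x hx
    have hdown : ∀ x ∈ X ++ Y, x ∈ downListP (tyInterp a) (X ++ Y) :=
      subset_down la fun x hx => ga.sub.car _ (hmem x hx)
    refine ⟨_, hf.comp (defX (X ++ Y) hmem hall), fun r hr => ?_⟩
    obtain ⟨s1, s2⟩ := hs _ (hr.aps (elem_down la hall))
    exact ⟨fun h => s1 ⟨X, fun x hx => hdown x (List.mem_append_left _ hx), h⟩,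
      fun h => s2 ⟨Y, fun x hx => hdown x (List.mem_append_right _ hx), h⟩⟩

theorem good_pre {s τ : TyExpr} (h : Pre s τ) : Good τ (interpSimple s) := by
  induction h with
  | void τ => exact good_void τ
  | sum _ _ i j => exact good_sum i j
  | prod _ _ i j => exact good_prod i j
  | arrow _ _ i j => exact good_arrow i j

theorem good_main {s σ : TyExpr} (h : s ∈ unfolding σ) : Good σ (interpSimple s) := by
  obtain ⟨τ, hτ, hs⟩ := h
  exact good_transfer hτ (good_pre hs)

/-- **Definability.**  For every type `σ` and every finite element
`d` of the domain `D_σ` — i.e. every downward closure of a finite consistent set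
of primes of `P(σ*)` — there is a closed typed term `M : σ` with `⟦M⟧⊥ = d`. -/
theorem definability (σ : TyExpr) (hσ : σ.Closed) (d : Set Pm)
    (hd : ∃ X : List Pm,
      (∀ x ∈ X, x ∈ (tyInterp σ).carrier) ∧
      (∀ x ∈ X, ∀ y ∈ X, (tyInterp σ).con x y) ∧
      d = downListP (tyInterp σ) X) :
    ∃ M : Tm, HasType [] M σ ∧ sem M botEnv = d := by
  obtain ⟨X, h1, h2, rfl⟩ := hd
  obtain ⟨s, hs, hX⟩ := common_simple X h1
  obtain ⟨M, m1, m2, -⟩ := (good_main hs).M X hX h2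
  exact ⟨M, m1 [], m2 botEnv⟩

end RecLam
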